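/- arXiv:1307.1810 — 5 statements merged into one kernel-verified Lean document; each statement's English description precedes it below -/
import Mathlib

section
/- Let D be an orientation of a simple graph G that is semi-transitive, and suppose G is K₄-free (G contains no four pairwise adjacent vertices). Then no 4-cycle of G has three consecutively oriented edges under D; that is, there do not exist four distinct vertices a,b,c,d with {a,b},{b,c},{c,d},{d,a} all edges of G such that a→b, b→c and c→d in D. -/
def IsOrientation {V : Type*} (G : SimpleGraph V) (R : V → V → Prop) : Prop :=
  (∀ x y : V, R x y → G.Adj x y) ∧ ∀ x y : V, G.Adj x y → (R x y ↔ ¬ R y x)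

/-- A relation is semi-transitive if it is acyclic and, for every directed path
`v 0 → v 1 → ⋯ → v (k-1)` on `k ≥ 4` vertices, whenever the edge `v 0 → v (k-1)`
is present, all edges `v i → v j` for `i < j < k` are present (no shortcuts). -/
def IsSemiTransitive {V : Type*} (R : V → V → Prop) : Prop :=
  (∀ v : V, ¬ Relation.TransGen R v v) ∧
  ∀ k : ℕ, 4 ≤ k → ∀ v : ℕ → V,
    (∀ i, i + 1 < k → R (v i) (v (i + 1))) →
    R (v 0) (v (k - 1)) →
    ∀ i j, i < j → j < k → R (v i) (v j)

theorem no_three_consecutive_in_C4 {V : Type*} (G : SimpleGraph V) (R : V → V → Prop)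
    (hR : IsOrientation G R) (hsemi : IsSemiTransitive R)
    (hK4 : ¬ ∃ a b c d : V,
      G.Adj a b ∧ G.Adj a c ∧ G.Adj a d ∧ G.Adj b c ∧ G.Adj b d ∧ G.Adj c d) :
    ¬ ∃ a b c d : V, a ≠ b ∧ a ≠ c ∧ a ≠ d ∧ b ≠ c ∧ b ≠ d ∧ c ≠ d ∧
      G.Adj a b ∧ G.Adj b c ∧ G.Adj c d ∧ G.Adj d a ∧ R a b ∧ R b c ∧ R c d := by
  rintro ⟨a, b, c, d, -, -, -, -, -, -, hab, hbc, hcd, hda, rab, rbc, rcd⟩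
  by_cases hd : R d a
  · exact hsemi.1 a ((((Relation.TransGen.single rab).tail rbc).tail rcd).tail hd)
  · have rad : R a d := (hR.2 a d hda.symm).2 hd
    let v : ℕ → V := fun i => if i = 0 then a else if i = 1 then b else if i = 2 then c else d
    have key := hsemi.2 4 le_rfl v (by
      intro i hi
      have h3 : i < 3 := by omega
      interval_cases i
      · simpa [v] using rab
      · simpa [v] using rbc
      · simpa [v] using rcd) (by simpa [v] using rad)
    have rac : R a c := by simpa [v] using key 0 2 (by norm_num) (by norm_num)
    have rbd : R b d := by simpa [v] using key 1 3 (by norm_num) (by norm_num)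
    exact hK4 ⟨a, b, c, d, hab, hR.1 _ _ rac, hda.symm, hbc, hR.1 _ _ rbd, hcd⟩
end

section
/- A finite simple graph is word-representable if and only if it admits a semi-transitive orientation. -/
def Alternates {V : Type*} [DecidableEq V] (w : List V) (x y : V) : Prop :=
  (w.filter (fun z => z = x ∨ z = y)).Chain' (· ≠ ·)

def Represents {V : Type*} [DecidableEq V] (w : List V) (G : SimpleGraph V) : Prop :=
  (∀ v : V, v ∈ w) ∧ ∀ x y : V, x ≠ y → (Alternates w x y ↔ G.Adj x y)

def WordRepresentable {V : Type*} [DecidableEq V] (G : SimpleGraph V) : Prop :=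
  ∃ w : List V, Represents w G

/-- In every prefix, `y` occurs at most as often as `x`, which occurs at most once more. -/
def Dom {V : Type*} [DecidableEq V] (w : List V) (x y : V) : Prop :=
  ∀ p, p <+: w → p.count y ≤ p.count x ∧ p.count x ≤ p.count y + 1

theorem dom_cons {V : Type*} [DecidableEq V] (a : V) (w : List V) (x y : V) :
    Dom (a :: w) x y ↔ ∀ p, p <+: w → (a :: p).count y ≤ (a :: p).count x ∧
      (a :: p).count x ≤ (a :: p).count y + 1 := by
  constructor
  · intro h p hp
    exact h (a :: p) (by simpa using hp)
  · intro h p hp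
    rcases p with _ | ⟨b, p⟩
    · simp
    · rw [List.cons_prefix_cons] at hp
      obtain ⟨rfl, hp⟩ := hp
      exact h p hp

theorem dom_iff_chain {V : Type*} [DecidableEq V] (w : List V) : ∀ (x y : V), x ≠ y →
    (Dom w x y ↔ (y :: w.filter (fun z => z = x ∨ z = y)).IsChain (· ≠ ·)) := by
  induction w with
  | nil => intro x y h; simp [Dom]
  | cons a w ih =>
    intro x y h
    rw [dom_cons]
    by_cases hx : a = x
    · subst hx
      have h2 := ih y a h.symm
      have e : (fun z => decide (z = y ∨ z = a)) = (fun z => decide (z = a ∨ z = y)) := by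
        funext z; simp [or_comm]
      rw [e] at h2
      rw [List.filter_cons_of_pos (by simp), List.isChain_cons_cons, ← h2]
      simp only [Dom, List.count_cons_self, List.count_cons_of_ne h]
      constructor
      · intro h3
        exact ⟨h.symm, fun p hp => ⟨by have := h3 p hp; omega, by have := h3 p hp; omega⟩⟩
      · rintro ⟨-, h3⟩ p hp
        have := h3 p hp
        omega
    · by_cases hy : a = y
      · subst hy
        rw [List.filter_cons_of_pos (by simp), List.isChain_cons_cons]
        simp only [ne_eq, not_true_eq_false, false_and, iff_false]
        intro h3
        have := h3 [] (by simp)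
        simp [h.symm] at this
      · rw [List.filter_cons_of_neg (by simp [hx, hy]), ← ih x y h]
        simp only [Dom, List.count_cons_of_ne hx, List.count_cons_of_ne hy]

theorem alternates_iff {V : Type*} [DecidableEq V] (w : List V) (x y : V) (h : x ≠ y) :
    Alternates w x y ↔ Dom w x y ∨ Dom w y x := by
  have e : (fun z => decide (z = y ∨ z = x)) = (fun z => decide (z = x ∨ z = y)) := by
    funext z; simp [or_comm]
  rw [dom_iff_chain w x y h, dom_iff_chain w y x h.symm, e]
  unfold Alternates
  change List.IsChain _ _ ↔ _
  have hm : ∀ z ∈ w.filter (fun z => z = x ∨ z = y), z = x ∨ z = y := by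
    intro z hz
    simpa using (List.mem_filter.1 hz).2
  generalize w.filter (fun z => z = x ∨ z = y) = f at hm
  rcases f with _ | ⟨a, f⟩
  · simp
  · simp only [List.isChain_cons_cons]
    rcases hm a (by simp) with rfl | rfl
    · simp [h.symm]
    · simp [h]

theorem dom_antisymm {V : Type*} [DecidableEq V] {w : List V} {x y : V} (h : x ≠ y)
    (hx : x ∈ w) (h1 : ∀ p, p <+: w → p.count y = p.count x) : False := by
  obtain ⟨s, t, rfl⟩ := List.append_of_mem hx
  have a := h1 s (by simp)
  have b := h1 (s ++ [x]) ⟨t, by simp⟩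
  simp [List.count_append, h] at b
  omega

theorem forward {V : Type*} [Fintype V] [DecidableEq V] (G : SimpleGraph V)
    (w : List V) (hw : Represents w G) :
    ∃ R : V → V → Prop, IsOrientation G R ∧ IsSemiTransitive R := by
  obtain ⟨hmem, hrep⟩ := hw
  have hmono : ∀ u v, Relation.ReflTransGen (fun x y => G.Adj x y ∧ Dom w x y) u v →
      ∀ p, p <+: w → p.count v ≤ p.count u := by
    intro u v h p hp
    induction h with
    | refl => exact le_rfl
    | tail _ h ih => exact (h.2 p hp).1.trans ih
  have hac : ∀ v : V, ¬ Relation.TransGen (fun x y => G.Adj x y ∧ Dom w x y) v v := by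
    intro v hv
    obtain ⟨u, h1, h2⟩ := Relation.TransGen.head'_iff.1 hv
    exact dom_antisymm h1.1.ne (hmem v) fun p hp =>
      le_antisymm (h1.2 p hp).1 (hmono _ _ h2 p hp)
  refine ⟨fun x y => G.Adj x y ∧ Dom w x y, ⟨fun x y h => h.1, fun x y h => ?_⟩, hac, ?_⟩
  · have h2 := (alternates_iff w x y h.ne).1 ((hrep x y h.ne).2 h)
    constructor
    · rintro h3 h4
      exact hac x (.tail (.single h3) h4)
    · intro h3
      refine ⟨h, h2.resolve_right fun h4 => h3 ⟨h.symm, h4⟩⟩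
  · intro k hk v hs he i j hij hjk
    have hr : ∀ i j, i ≤ j → j < k →
        Relation.ReflTransGen (fun x y => G.Adj x y ∧ Dom w x y) (v i) (v j) := by
      intro i j hij
      induction j, hij using Nat.le_induction with
      | base => intro _; exact .refl
      | succ j hj ih => intro h; exact (ih (by omega)).tail (hs j h)
    have hne : v i ≠ v j := by
      intro h
      have : Relation.TransGen (fun x y => G.Adj x y ∧ Dom w x y) (v i) (v j) :=
        Relation.TransGen.head' (hs i (by omega)) (hr (i+1) j hij hjk)
      rw [← h] at this
      exact hac _ this
    have hd : Dom w (v i) (v j) := by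
      intro p hp
      have h1 := hmono _ _ (hr i j hij.le hjk) p hp
      have h2 := hmono _ _ (hr 0 i (by omega) (by omega)) p hp
      have h3 := hmono _ _ (hr j (k-1) (by omega) (by omega)) p hp
      have h4 := (he.2 p hp).2
      omega
    exact ⟨(hrep _ _ hne).1 ((alternates_iff w _ _ hne).2 (Or.inl hd)), hd⟩

theorem path_prepend {V : Type*} {R : V → V → Prop} {v : ℕ → V} {n : ℕ} {d : V}
    (hs : ∀ i, i < n → R (v i) (v (i + 1))) (hd : R d (v 0)) :
    ∃ v' : ℕ → V, v' 0 = d ∧ (∀ i, v' (i + 1) = v i) ∧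
      ∀ i, i < n + 1 → R (v' i) (v' (i + 1)) := by
  refine ⟨fun i => Nat.casesOn i d v, rfl, fun i => rfl, ?_⟩
  rintro (_ | i) hi
  · exact hd
  · exact hs i (by omega)

theorem path_one {V : Type*} {R : V → V → Prop} {y p : V}
    (hyp : Relation.ReflTransGen R y p) :
    ∃ (v : ℕ → V) (n : ℕ), v 0 = y ∧ v n = p ∧ ∀ i, i < n → R (v i) (v (i + 1)) := by
  induction hyp using Relation.ReflTransGen.head_induction_on with
  | refl => exact ⟨fun _ => p, 0, rfl, rfl, by simp⟩
  | head h _ ih =>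
    obtain ⟨v, n, h0, hn, hs⟩ := ih
    obtain ⟨v', h0', h1, h2⟩ := path_prepend hs (h0 ▸ h)
    exact ⟨v', n + 1, h0', by rw [h1, hn], h2⟩

theorem path_two {V : Type*} {R : V → V → Prop} {x y p : V}
    (hxy : Relation.ReflTransGen R x y) (hyp : Relation.ReflTransGen R y p) :
    ∃ (v : ℕ → V) (n j : ℕ), v 0 = x ∧ v j = y ∧ j ≤ n ∧ v n = p ∧
      ∀ i, i < n → R (v i) (v (i + 1)) := by
  induction hxy using Relation.ReflTransGen.head_induction_on with
  | refl =>
    obtain ⟨v, n, h0, hn, hs⟩ := path_one hyp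
    exact ⟨v, n, 0, h0, h0, by omega, hn, hs⟩
  | head h _ ih =>
    obtain ⟨v, n, j, h0, hj, hjn, hn, hs⟩ := ih
    obtain ⟨v', h0', h1, h2⟩ := path_prepend hs (h0 ▸ h)
    exact ⟨v', n + 1, j + 1, h0', by rw [h1, hj], by omega, by rw [h1, hn], h2⟩

theorem path_three {V : Type*} {R : V → V → Prop} {q x y p : V}
    (hqx : Relation.ReflTransGen R q x) (hne : x ≠ y)
    (hxy : Relation.ReflTransGen R x y) (hyp : Relation.ReflTransGen R y p) :
    ∃ (v : ℕ → V) (n i j : ℕ), v 0 = q ∧ v i = x ∧ i < j ∧ v j = y ∧ j ≤ n ∧ v n = p ∧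
      ∀ i, i < n → R (v i) (v (i + 1)) := by
  induction hqx using Relation.ReflTransGen.head_induction_on with
  | refl =>
    obtain ⟨v, n, j, h0, hj, hjn, hn, hs⟩ := path_two hxy hyp
    refine ⟨v, n, 0, j, h0, h0, Nat.pos_of_ne_zero ?_, hj, hjn, hn, hs⟩
    rintro rfl
    exact hne (h0.symm.trans hj)
  | head h _ ih =>
    obtain ⟨v, n, i, j, h0, hi, hij, hj, hjn, hn, hs⟩ := ih
    obtain ⟨v', h0', h1, h2⟩ := path_prepend hs (h0 ▸ h)
    exact ⟨v', n + 1, i + 1, j + 1, h0', by rw [h1, hi], by omega, by rw [h1, hj], by omega,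
      by rw [h1, hn], h2⟩

theorem no_shortcut {V : Type*} {R : V → V → Prop} (hR : IsSemiTransitive R)
    {q p x y : V} (hqp : R q p) (hqx : Relation.ReflTransGen R q x)
    (hxy : Relation.ReflTransGen R x y) (hne : x ≠ y) (hyp : Relation.ReflTransGen R y p) :
    R x y := by
  obtain ⟨v, n, i, j, h0, hi, hij, hj, hjn, hn, hs⟩ := path_three hqx hne hxy hyp
  subst h0 hi hj hn
  by_cases h3 : 3 ≤ n
  · exact hR.2 (n + 1) (by omega) v (fun i h => hs i (by omega)) (by simpa using hqp) i j hij
      (by omega)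
  · by_cases hji : j = i + 1
    · subst hji
      exact hs i (by omega)
    · have h1 : i = 0 := by omega
      have h2 : j = n := by omega
      rw [h1, h2]
      exact hqp

/-- Uniform words in which every edge of `R` alternates in the correct direction. -/
def GoodWord {V : Type*} [DecidableEq V] (R : V → V → Prop) (w : List V) : Prop :=
  (∃ k, ∀ v, w.count v = k) ∧ ∀ u z, R u z → Dom w u z

theorem dom_append {V : Type*} [DecidableEq V] {w₁ w₂ : List V} {x y : V}
    (h : w₁.count x = w₁.count y) : Dom (w₁ ++ w₂) x y ↔ Dom w₁ x y ∧ Dom w₂ x y := by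
  constructor
  · intro hd
    refine ⟨fun p hp => hd p (hp.trans (List.prefix_append _ _)), fun p hp => ?_⟩
    have := hd (w₁ ++ p) ((List.prefix_append_right_inj _).2 hp)
    simp only [List.count_append] at this
    omega
  · rintro ⟨h1, h2⟩ p hp
    obtain ⟨r, hr⟩ := hp
    rcases List.append_eq_append_iff.1 hr with ⟨t, ht, -⟩ | ⟨t, rfl, ht⟩
    · exact h1 p ⟨t, ht.symm⟩
    · have := h2 t ⟨r, ht.symm⟩
      simp only [List.count_append]
      omega

theorem GoodWord.append {V : Type*} [DecidableEq V] {R : V → V → Prop} {w₁ w₂ : List V}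
    (h1 : GoodWord R w₁) (h2 : GoodWord R w₂) : GoodWord R (w₁ ++ w₂) := by
  obtain ⟨⟨k, hk⟩, h1⟩ := h1
  obtain ⟨⟨m, hm⟩, h2⟩ := h2
  refine ⟨⟨k + m, fun v => by rw [List.count_append, hk, hm]⟩, fun u z h => ?_⟩
  exact (dom_append (by rw [hk, hk])).2 ⟨h1 u z h, h2 u z h⟩

theorem count_map_fst {V : Type*} [DecidableEq V] (l : List (V × Bool)) (v : V) :
    (l.map Prod.fst).count v = l.count (v, false) + l.count (v, true) := by
  induction l with
  | nil => simp
  | cons a l ih =>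
    obtain ⟨a, b⟩ := a
    simp only [List.map_cons, List.count_cons, ih, beq_iff_eq, Prod.mk.injEq]
    by_cases h : a = v <;> cases b <;> simp [h] <;> omega

/-- The constraints for a two-uniform word. -/
inductive Lev {V : Type*} (R : V → V → Prop) : V × Bool → V × Bool → Prop
  | up (u : V) : Lev R (u, false) (u, true)
  | same (u z : V) (b : Bool) : R u z → Lev R (u, b) (z, b)
  | back (u z : V) : R u z → Lev R (z, false) (u, true)

theorem exists_rank {V : Type*} [Fintype V] {R : V → V → Prop}
    (hR : ∀ v : V, ¬ Relation.TransGen R v v) :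
    ∃ f : V × Bool → ℕ, ∀ a b, Lev R a b → f a < f b := by
  classical
  let g : V → ℕ := fun v => (Finset.univ.filter (fun u => Relation.TransGen R u v)).card
  have hg : ∀ u z, R u z → g u < g z := by
    intro u z h
    apply Finset.card_lt_card
    rw [Finset.ssubset_iff_of_subset]
    · exact ⟨u, by simpa using Relation.TransGen.single h, by simpa using hR u⟩
    · intro t ht
      simp only [Finset.mem_filter, Finset.mem_univ, true_and] at ht ⊢
      exact ht.tail h
  have hb : ∀ v, g v < Fintype.card V + 1 := fun v => Nat.lt_succ_of_le (Finset.card_le_univ _)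
  refine ⟨fun a => g a.1 + if a.2 then Fintype.card V + 1 else 0, ?_⟩
  intro a b h
  cases h with
  | up u => simp
  | same u z b h => simpa using hg u z h
  | back u z h => have := hb z; simp; omega

theorem exists_block {V : Type*} [Fintype V] [DecidableEq V] {R : V → V → Prop}
    (hR : ∀ v : V, ¬ Relation.TransGen R v v) (s : V × Bool → Prop)
    (hs : ∀ a b, Lev R a b → s b → s a) :
    ∃ w : List V, GoodWord R w ∧ (∀ v, v ∈ w) ∧ ∃ p, p <+: w ∧
      (∀ v, s (v, true) → p.count v = 2) ∧ (∀ v, s (v, false) → 1 ≤ p.count v) ∧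
      (∀ v, ¬ s (v, false) → p.count v = 0) := by
  classical
  obtain ⟨f, hf⟩ := exists_rank hR
  obtain ⟨l, hnd, hmem, hpw⟩ : ∃ l : List (V × Bool), l.Nodup ∧ (∀ a, a ∈ l) ∧
      l.Pairwise (fun a b => ¬ Lev R b a) := by
    let l := (Finset.univ : Finset (V × Bool)).toList.insertionSort (fun a b => f a ≤ f b)
    have hp : l.Perm (Finset.univ : Finset (V × Bool)).toList := List.perm_insertionSort _ _
    have : Std.Total (fun a b : V × Bool => f a ≤ f b) := ⟨fun a b => le_total _ _⟩
    have : IsTrans (V × Bool) (fun a b : V × Bool => f a ≤ f b) := ⟨fun a b c => le_trans⟩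
    refine ⟨l, hp.nodup_iff.2 (Finset.nodup_toList _), fun a => hp.mem_iff.2 (by simp), ?_⟩
    have := List.pairwise_insertionSort (fun a b : V × Bool => f a ≤ f b)
      (Finset.univ : Finset (V × Bool)).toList
    exact this.imp fun h h' => absurd (hf _ _ h') (not_lt.2 h)
  set l1 := l.filter (fun a => s a) with hl1
  set l2 := l.filter (fun a => ¬ s a) with hl2
  have hm1 : ∀ a, a ∈ l1 ↔ s a := fun a => by simp [hl1, hmem]
  have hm2 : ∀ a, a ∈ l2 ↔ ¬ s a := fun a => by simp [hl2, hmem]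
  have hn : (l1 ++ l2).Nodup := by
    rw [List.nodup_append']
    exact ⟨hnd.filter _, hnd.filter _, fun a h1 h2 => (hm2 a).1 h2 ((hm1 a).1 h1)⟩
  have hp : (l1 ++ l2).Pairwise (fun a b => ¬ Lev R b a) := by
    rw [List.pairwise_append]
    exact ⟨hpw.filter _, hpw.filter _,
      fun a h1 b h2 h => (hm2 b).1 h2 (hs _ _ h ((hm1 a).1 h1))⟩
  have hm : ∀ a, a ∈ l1 ++ l2 := fun a => by
    rw [List.mem_append, hm1, hm2]; exact em _
  have hc : ∀ p, p <+: l1 ++ l2 → ∀ a, p.count a = if a ∈ p then 1 else 0 := by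
    intro p hp a
    exact (hn.sublist hp.sublist).count
  have hdown : ∀ p, p <+: l1 ++ l2 → ∀ a b, Lev R a b → b ∈ p → a ∈ p := by
    rintro p ⟨t, ht⟩ a b hab hb
    by_contra ha
    have hat : a ∈ t := by
      have := hm a
      rw [← ht, List.mem_append] at this
      exact this.resolve_left ha
    rw [← ht, List.pairwise_append] at hp
    exact hp.2.2 b hb a hat hab
  refine ⟨(l1 ++ l2).map Prod.fst, ⟨⟨2, fun v => ?_⟩, fun u z huz p hp => ?_⟩, fun v => ?_,
    l1.map Prod.fst, ?_, fun v hv => ?_, fun v hv => ?_, fun v hv => ?_⟩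
  · rw [count_map_fst, hc _ List.prefix_rfl, hc _ List.prefix_rfl, if_pos (hm _), if_pos (hm _)]
  · obtain ⟨p, hpp, rfl⟩ := List.prefix_map_iff.1 hp
    clear hp
    have hp := hpp
    have h1 := hdown p hp _ _ (.same u z false huz)
    have h2 := hdown p hp _ _ (.same u z true huz)
    have h3 := hdown p hp _ _ (.back u z huz)
    have h4 := hdown p hp _ _ (.up u)
    simp only [count_map_fst, hc p hp]
    split_ifs <;> simp_all
  · exact List.mem_map.2 ⟨(v, false), hm _, rfl⟩
  · rw [List.map_append]
    exact List.prefix_append _ _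
  · rw [count_map_fst, hc _ (List.prefix_append _ _), hc _ (List.prefix_append _ _),
      if_pos ((hm1 _).2 hv), if_pos ((hm1 _).2 (hs _ _ (.up v) hv))]
  · rw [count_map_fst, hc _ (List.prefix_append _ _), if_pos ((hm1 _).2 hv)]
    omega
  · rw [count_map_fst, hc _ (List.prefix_append _ _), hc _ (List.prefix_append _ _),
      if_neg (fun h => hv ((hm1 _).1 h)),
      if_neg (fun h => hv (hs _ _ (.up v) ((hm1 _).1 h)))]

theorem exists_sep {V : Type*} [Fintype V] [DecidableEq V] {R : V → V → Prop}
    (hR : IsSemiTransitive R) {x y : V} (hne : x ≠ y) (hxy : ¬ R x y) :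
    ∃ w : List V, GoodWord R w ∧ ¬ Dom w x y := by
  by_cases h : Relation.ReflTransGen R x y
  · obtain ⟨w, hw, -, p, hp, h2, -, h0⟩ := exists_block hR.1
      (fun a => Relation.ReflTransGen R a.1 x ∨ (a.2 = false ∧
        ∃ q p, Relation.ReflTransGen R q x ∧ R q p ∧ Relation.ReflTransGen R a.1 p)) (by
        intro a b hab hb
        cases hab with
        | up u => simp at hb ⊢; exact Or.inl hb
        | same u z b hh =>
          rcases hb with hb | ⟨hb, q, p, h1, h2, h3⟩
          · exact Or.inl (hb.head hh)
          · exact Or.inr ⟨hb, q, p, h1, h2, h3.head hh⟩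
        | back u z hh =>
          simp only [Bool.true_eq_false, false_and, or_false] at hb
          exact Or.inr ⟨rfl, u, z, hb, hh, .refl⟩)
    refine ⟨w, hw, fun hd => ?_⟩
    have a := h2 x (Or.inl .refl)
    have b := h0 y (by
      rintro (h1 | ⟨-, q, p, h1, h2, h3⟩)
      · rcases Relation.reflTransGen_iff_eq_or_transGen.1 h with h4 | h4
        · exact hne h4.symm
        · exact hR.1 x (h4.trans_left h1)
      · exact hxy (no_shortcut hR h2 h1 h hne h3))
    have := hd p hp
    omega
  · obtain ⟨w, hw, -, p, hp, -, h1, h0⟩ := exists_block hR.1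
      (fun a => a.2 = false ∧ Relation.ReflTransGen R a.1 y) (by
        intro a b hab hb
        cases hab with
        | up u => simp at hb
        | same u z b hh => exact ⟨hb.1, hb.2.head hh⟩
        | back u z hh => simp at hb)
    refine ⟨w, hw, fun hd => ?_⟩
    have a := h1 y ⟨rfl, .refl⟩
    have b := h0 x (fun hx => h hx.2)
    have := hd p hp
    omega

theorem exists_word {V : Type*} [Fintype V] [DecidableEq V] {R : V → V → Prop}
    (hR : IsSemiTransitive R) (t : Finset (V × V)) :
    ∃ w : List V, GoodWord R w ∧ (∀ v, v ∈ w) ∧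
      ∀ a ∈ t, a.1 ≠ a.2 → ¬ R a.1 a.2 → ¬ Dom w a.1 a.2 := by
  induction t using Finset.induction_on with
  | empty =>
    obtain ⟨w, hw, hm, -⟩ := exists_block hR.1 (fun _ => True) (fun _ _ _ _ => trivial)
    exact ⟨w, hw, hm, by simp⟩
  | insert a t _ ih =>
    obtain ⟨w, hw, hm, ht⟩ := ih
    by_cases h : a.1 ≠ a.2 ∧ ¬ R a.1 a.2
    · obtain ⟨w', hw', hd⟩ := exists_sep hR h.1 h.2
      obtain ⟨k, hk⟩ := hw.1
      refine ⟨w ++ w', hw.append hw', fun v => List.mem_append_left _ (hm v), ?_⟩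
      intro b hb hne hr
      rw [dom_append (by rw [hk, hk])]
      rcases Finset.mem_insert.1 hb with rfl | hb
      · exact fun h => hd h.2
      · exact fun h => ht b hb hne hr h.1
    · refine ⟨w, hw, hm, fun b hb hne hr => ?_⟩
      rcases Finset.mem_insert.1 hb with rfl | hb
      · exact absurd ⟨hne, hr⟩ h
      · exact ht b hb hne hr

theorem wordRepresentable_iff_semiTransitive {V : Type*} [Fintype V] [DecidableEq V]
    (G : SimpleGraph V) :
    WordRepresentable G ↔ ∃ R : V → V → Prop, IsOrientation G R ∧ IsSemiTransitive R := by
  constructor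
  · rintro ⟨w, hw⟩
    exact forward G w hw
  · rintro ⟨R, ⟨h1, h2⟩, hR⟩
    obtain ⟨w, hw, hm, ht⟩ := exists_word hR Finset.univ
    refine ⟨w, hm, fun x y hne => ?_⟩
    rw [alternates_iff w x y hne]
    constructor
    · rintro (h | h)
      · by_contra hn
        exact ht (x, y) (by simp) hne (fun h => hn (h1 _ _ h)) h
      · by_contra hn
        exact ht (y, x) (by simp) hne.symm (fun h => hn (h1 _ _ h).symm) h
    · intro h
      by_cases hr : R y x
      · exact Or.inr (hw.2 _ _ hr)
      · exact Or.inl (hw.2 _ _ ((h2 x y h).2 hr))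
end

section
/- Every 3-colorable finite simple graph is word-representable. -/
namespace WR

variable {V : Type*} [DecidableEq V]

/-- The subword on the letters `x`, `y`. -/
def res (w : List V) (x y : V) : List V := w.filter (fun z => z = x ∨ z = y)

/-- In the word every edge, oriented by colour, restricts to a power of `xy`. -/
def Good (G : SimpleGraph V) (c : V → Fin 3) (w : List V) : Prop :=
  ∀ x y, G.Adj x y → c x < c y → ∃ k, res w x y = (List.replicate k [x, y]).flatten

lemma res_append (a b : List V) (x y : V) : res (a ++ b) x y = res a x y ++ res b x y := by
  simp [res]

lemma res_comm (a : List V) (x y : V) : res a x y = res a y x := by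
  simp [res, or_comm]

lemma res_piece (L : List V) (hL : L.Nodup) (hm : ∀ v, v ∈ L) (p : V → Prop) [DecidablePred p]
    (x y : V) (h : ¬ (p x ∧ p y)) :
    res (L.filter p) x y = (if p x then [x] else []) ++ (if p y then [y] else []) := by
  have key : ∀ x, p x → L.filter (fun z => decide (z = x)) = [x] := by
    intro x _
    have := List.filter_eq (l := L) x
    rw [hL.count, if_pos (hm x)] at this
    simpa [eq_comm] using this
  unfold res
  rw [List.filter_filter]
  by_cases hx : p x
  · have hy : ¬ p y := fun hy => h ⟨hx, hy⟩
    simp only [hx, hy, if_true, if_false, List.append_nil]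
    rw [← key x hx]
    apply List.filter_congr
    intro z _
    by_cases hz : z = x
    · subst hz; simp [hx]
    · by_cases hz' : z = y
      · subst hz'; simp [hy, hz]
      · simp [hz, hz']
  · by_cases hy : p y
    · simp only [hx, hy, if_true, if_false, List.nil_append]
      rw [← key y hy]
      apply List.filter_congr
      intro z _
      by_cases hz : z = y
      · subst hz; simp [hy]
      · by_cases hz' : z = x
        · subst hz'; simp [hx, hz]
        · simp [hz, hz']
    · simp only [hx, hy, if_false, List.append_nil]
      rw [List.filter_eq_nil_iff]
      intro z _
      simp only [Bool.and_eq_true, decide_eq_true_eq, not_and]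
      rintro (rfl | rfl) <;> assumption

lemma good_append {G : SimpleGraph V} {c : V → Fin 3} {a b : List V} (ha : Good G c a)
    (hb : Good G c b) : Good G c (a ++ b) := by
  intro x y h1 h2
  obtain ⟨k, hk⟩ := ha x y h1 h2
  obtain ⟨l, hl⟩ := hb x y h1 h2
  exact ⟨k + l, by rw [res_append, hk, hl, List.replicate_add, List.flatten_append]⟩

lemma good_flatMap {ι : Type*} {G : SimpleGraph V} {c : V → Fin 3} (f : ι → List V)
    (hf : ∀ i, Good G c (f i)) (l : List ι) : Good G c (l.flatMap f) := by
  induction l with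
  | nil => intro x y _ _; exact ⟨0, by simp [res]⟩
  | cons i l ih => rw [List.flatMap_cons]; exact good_append (hf i) ih

lemma chain_pow (x y : V) (h : x ≠ y) (k : ℕ) :
    ((List.replicate k [x, y]).flatten).IsChain (· ≠ ·) := by
  induction k with
  | zero => simp
  | succ k ih =>
    rw [List.replicate_succ, List.flatten_cons]
    cases k with
    | zero => simpa using h
    | succ k =>
      rw [List.replicate_succ, List.flatten_cons] at ih ⊢
      simp only [List.cons_append, List.nil_append, List.isChain_cons_cons] at ih ⊢
      exact ⟨h, h.symm, ih⟩

lemma edge_cases {i j : Fin 3} (h : i < j) :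
    (i = 0 ∧ j = 1) ∨ (i = 0 ∧ j = 2) ∨ (i = 1 ∧ j = 2) := by
  revert i j
  decide

lemma good_base {G : SimpleGraph V} {c : V → Fin 3} (L : List V) (hL : L.Nodup)
    (hm : ∀ v, v ∈ L) :
    Good G c (L.filter (fun z => c z = 0) ++ L.filter (fun z => c z = 1) ++
      L.filter (fun z => c z = 2)) := by
  intro x y h hlt
  refine ⟨1, ?_⟩
  simp only [res_append]
  rw [res_piece L hL hm _ x y (by grind), res_piece L hL hm _ x y (by grind),
    res_piece L hL hm _ x y (by grind)]
  generalize c x = i at *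
  generalize c y = j at *
  fin_cases i <;> fin_cases j <;> simp at hlt ⊢

/-- A word separating two vertices of equal colour. -/
lemma sep_same {G : SimpleGraph V} {c : V → Fin 3} (L : List V) (hL : L.Nodup)
    (hm : ∀ v, v ∈ L) (u v : V) (huv : u ≠ v) (hc : c u = c v) :
    ∃ w, Good G c w ∧ ¬ (res w u v).IsChain (· ≠ ·) := by
  refine ⟨(L.filter (fun z => c z = 0 ∧ z = u) ++ L.filter (fun z => c z = 0 ∧ z ≠ u) ++
    L.filter (fun z => c z = 1 ∧ z = u) ++ L.filter (fun z => c z = 1 ∧ z ≠ u) ++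
    L.filter (fun z => c z = 2 ∧ z = u) ++ L.filter (fun z => c z = 2 ∧ z ≠ u)) ++
    (L.filter (fun z => c z = 0 ∧ z ≠ u) ++ L.filter (fun z => c z = 0 ∧ z = u) ++
    L.filter (fun z => c z = 1 ∧ z ≠ u) ++ L.filter (fun z => c z = 1 ∧ z = u) ++
    L.filter (fun z => c z = 2 ∧ z ≠ u) ++ L.filter (fun z => c z = 2 ∧ z = u)), ?_, ?_⟩
  · intro x y h hlt
    refine ⟨2, ?_⟩
    simp only [res_append]
    repeat rw [res_piece L hL hm _ x y (by grind)]
    generalize c x = i at *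
    generalize c y = j at *
    by_cases hx : x = u <;> by_cases hy : y = u <;>
    fin_cases i <;> fin_cases j <;> simp [hx, hy, List.replicate] at hlt ⊢
  · simp only [res_append]
    repeat rw [res_piece L hL hm _ u v (by grind)]
    rw [← hc]
    generalize c u = i at *
    fin_cases i <;> simp [huv.symm]

/-- A word separating nonadjacent vertices of colours 0, 1. -/
lemma sep01 {G : SimpleGraph V} {c : V → Fin 3} (L : List V) (hL : L.Nodup)
    (hm : ∀ v, v ∈ L) (u v : V) (hn : ¬ G.Adj u v) (hu : c u = 0) (hv : c v = 1) :
    ∃ w, Good G c w ∧ ¬ (res w u v).IsChain (· ≠ ·) := by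
  have huv : u ≠ v := by rintro rfl; simp [hu] at hv
  refine ⟨(L.filter (fun z => c z = 0) ++ L.filter (fun z => c z = 1) ++
      L.filter (fun z => c z = 2)) ++ (L.filter (fun z => c z = 0 ∧ z ≠ u) ++
      L.filter (fun z => z = v) ++ L.filter (fun z => z = u) ++
      L.filter (fun z => c z = 1 ∧ z ≠ v) ++ L.filter (fun z => c z = 2)), ?_, ?_⟩
  · intro x y h hlt
    refine ⟨2, ?_⟩
    simp only [res_append]
    repeat rw [res_piece L hL hm _ x y (by grind)]
    rcases edge_cases hlt with ⟨hx, hy⟩ | ⟨hx, hy⟩ | ⟨hx, hy⟩ <;>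
    by_cases h1 : x = u <;> by_cases h2 : x = v <;> by_cases h3 : y = u <;>
    by_cases h4 : y = v <;> first | (exfalso; grind) | simp [hx, hy, h1, h2, h3, h4, hu, hv, huv, huv.symm, List.replicate]
  · simp only [res_append]
    repeat rw [res_piece L hL hm _ u v (by grind)]
    simp [hu, hv, huv, huv.symm]

/-- A word separating nonadjacent vertices of colours 1, 2. -/
lemma sep12 {G : SimpleGraph V} {c : V → Fin 3} (L : List V) (hL : L.Nodup)
    (hm : ∀ v, v ∈ L) (u v : V) (hn : ¬ G.Adj u v) (hu : c u = 1) (hv : c v = 2) :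
    ∃ w, Good G c w ∧ ¬ (res w u v).IsChain (· ≠ ·) := by
  have huv : u ≠ v := by rintro rfl; simp [hu] at hv
  refine ⟨(L.filter (fun z => c z = 0) ++ L.filter (fun z => c z = 1) ++
      L.filter (fun z => c z = 2)) ++ (L.filter (fun z => c z = 0) ++
      L.filter (fun z => c z = 1 ∧ z ≠ u) ++
      L.filter (fun z => z = v) ++ L.filter (fun z => z = u) ++
      L.filter (fun z => c z = 2 ∧ z ≠ v)), ?_, ?_⟩
  · intro x y h hlt
    refine ⟨2, ?_⟩
    simp only [res_append]
    repeat rw [res_piece L hL hm _ x y (by grind)]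
    rcases edge_cases hlt with ⟨hx, hy⟩ | ⟨hx, hy⟩ | ⟨hx, hy⟩ <;>
    by_cases h1 : x = u <;> by_cases h2 : x = v <;> by_cases h3 : y = u <;>
    by_cases h4 : y = v <;> first | (exfalso; grind) | simp [hx, hy, h1, h2, h3, h4, hu, hv, huv, huv.symm, List.replicate]
  · simp only [res_append]
    repeat rw [res_piece L hL hm _ u v (by grind)]
    simp [hu, hv, huv, huv.symm]

/-- A word separating nonadjacent vertices of colours 0, 2. -/
lemma sep02 {G : SimpleGraph V} {c : V → Fin 3} (L : List V) (hL : L.Nodup)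
    (hm : ∀ v, v ∈ L) (u v : V) (hn : ¬ G.Adj u v) (hu : c u = 0) (hv : c v = 2) :
    ∃ w, Good G c w ∧ ¬ (res w u v).IsChain (· ≠ ·) := by
  have huv : u ≠ v := by rintro rfl; simp [hu] at hv
  refine ⟨L.filter (fun z => c z = 0) ++ L.filter (fun z => c z = 1) ++
      L.filter (fun z => c z = 2 ∧ z ≠ v) ++ L.filter (fun z => z = u) ++
      L.filter (fun z => z = v) ++ L.filter (fun z => c z = 0 ∧ z ≠ u) ++
      L.filter (fun z => c z = 1) ++ L.filter (fun z => c z = 2), ?_, ?_⟩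
  · intro x y h hlt
    refine ⟨2, ?_⟩
    simp only [res_append]
    repeat rw [res_piece L hL hm _ x y (by grind)]
    rcases edge_cases hlt with ⟨hx, hy⟩ | ⟨hx, hy⟩ | ⟨hx, hy⟩ <;>
    by_cases h1 : x = u <;> by_cases h2 : x = v <;> by_cases h3 : y = u <;>
    by_cases h4 : y = v <;> first | (exfalso; grind) | simp [hx, hy, h1, h2, h3, h4, hu, hv, huv, huv.symm, List.replicate]
  · simp only [res_append]
    repeat rw [res_piece L hL hm _ u v (by grind)]
    simp [hu, hv, huv, huv.symm]

lemma sep {G : SimpleGraph V} {c : V → Fin 3} (L : List V) (hL : L.Nodup)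
    (hm : ∀ v, v ∈ L) (u v : V) (huv : u ≠ v) (hn : ¬ G.Adj u v) :
    ∃ w, Good G c w ∧ ¬ (res w u v).IsChain (· ≠ ·) := by
  have hn' : ¬ G.Adj v u := fun h => hn h.symm
  have hcases : c u = c v ∨ (c u = 0 ∧ c v = 1) ∨ (c u = 1 ∧ c v = 2) ∨ (c u = 0 ∧ c v = 2) ∨
      (c v = 0 ∧ c u = 1) ∨ (c v = 1 ∧ c u = 2) ∨ (c v = 0 ∧ c u = 2) := by
    generalize c u = i
    generalize c v = j
    revert i j
    decide
  rcases hcases with h | ⟨h, h'⟩ | ⟨h, h'⟩ | ⟨h, h'⟩ | ⟨h, h'⟩ | ⟨h, h'⟩ | ⟨h, h'⟩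
  · exact sep_same L hL hm u v huv h
  · exact sep01 L hL hm u v hn h h'
  · exact sep12 L hL hm u v hn h h'
  · exact sep02 L hL hm u v hn h h'
  · simp only [fun w => res_comm w u v]; exact sep01 L hL hm v u hn' h h'
  · simp only [fun w => res_comm w u v]; exact sep12 L hL hm v u hn' h h'
  · simp only [fun w => res_comm w u v]; exact sep02 L hL hm v u hn' h h'

end WR

theorem colorable_three_wordRepresentable {V : Type*} [Fintype V] [DecidableEq V]
    (G : SimpleGraph V) (h : G.Colorable 3) : WordRepresentable G := by
  obtain ⟨c⟩ := h
  have hL : (Finset.univ : Finset V).toList.Nodup := Finset.nodup_toList _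
  have hm : ∀ v, v ∈ (Finset.univ : Finset V).toList := by simp
  generalize (Finset.univ : Finset V).toList = L at hL hm
  have hb := WR.good_base (G := G) (c := c) L hL hm
  set b := L.filter (fun z => c z = 0) ++ L.filter (fun z => c z = 1) ++
      L.filter (fun z => c z = 2) with hbdef
  have hex : ∀ p : V × V, ∃ w, WR.Good G c w ∧
      (p.1 ≠ p.2 → ¬ G.Adj p.1 p.2 → ¬ (WR.res w p.1 p.2).IsChain (· ≠ ·)) := by
    rintro ⟨u, v⟩
    by_cases huv : u ≠ v ∧ ¬ G.Adj u v
    · obtain ⟨w, h1, h2⟩ := WR.sep (c := c) L hL hm u v huv.1 huv.2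
      exact ⟨w, h1, fun _ _ => h2⟩
    · exact ⟨b, hb, fun h1 h2 => absurd ⟨h1, h2⟩ huv⟩
  choose f hf hf' using hex
  have hg := WR.good_append hb (WR.good_flatMap f hf (Finset.univ : Finset (V × V)).toList)
  refine ⟨b ++ (Finset.univ : Finset (V × V)).toList.flatMap f, ?_, fun x y hxy => ⟨?_, ?_⟩⟩
  · intro v
    have : c v = 0 ∨ c v = 1 ∨ c v = 2 := by
      generalize c v = i
      revert i
      decide
    apply List.mem_append_left
    simp [hbdef, hm, this]
  · intro hA
    by_contra hn
    apply hf' (x, y) hxy hn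
    have h1 : f (x, y) <:+: b ++ (Finset.univ : Finset (V × V)).toList.flatMap f := by
      obtain ⟨s, t, hst⟩ := List.append_of_mem
        (Finset.mem_toList.2 (Finset.mem_univ (x, y)))
      rw [hst]
      exact ⟨b ++ s.flatMap f, t.flatMap f, by simp⟩
    obtain ⟨s, t, hst⟩ := h1
    have hA2 : (WR.res (s ++ f (x, y) ++ t) x y).IsChain (· ≠ ·) := by rw [hst]; exact hA
    rw [WR.res_append, WR.res_append] at hA2
    exact hA2.left_of_append.right_of_append
  · intro hadj
    have hne := c.valid hadj
    change (WR.res _ x y).IsChain (· ≠ ·)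
    rcases lt_or_gt_of_ne hne with hlt | hlt
    · obtain ⟨k, hk⟩ := hg x y hadj hlt
      rw [hk]
      exact WR.chain_pow x y hxy k
    · obtain ⟨k, hk⟩ := hg y x hadj.symm hlt
      rw [WR.res_comm, hk]
      exact WR.chain_pow y x hxy.symm k
end

section
/- If a word w represents a finite simple graph G and x is a vertex of G, then the word obtained from w by deleting all occurrences of the letter x represents the graph G − x obtained from G by deleting the vertex x (i.e. the subgraph of G induced by all vertices other than x). -/
theorem map_val_filter_aux {V : Type*} [DecidableEq V] (x : V) (a b : {y : V // y ≠ x})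
    (w : List V) :
    ((w.filterMap (fun z => if h : z ≠ x then some (⟨z, h⟩ : {y : V // y ≠ x}) else none)).filter
      (fun z => z = a ∨ z = b)).map Subtype.val
      = w.filter (fun z => z = a.1 ∨ z = b.1) := by
  induction w with
  | nil => rfl
  | cons c t ih =>
    by_cases hc : c = x
    · have ha : ¬ (c = a.1) := fun h => a.2 (h.symm.trans hc)
      have hb : ¬ (c = b.1) := fun h => b.2 (h.symm.trans hc)
      rw [List.filterMap_cons_none (by simp [hc]), ih, List.filter_cons_of_neg (by simp [ha, hb])]
    · rw [List.filterMap_cons_some (b := ⟨c, hc⟩) (by simp [hc])]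
      by_cases h : c = a.1 ∨ c = b.1
      · rw [List.filter_cons_of_pos (by simpa [Subtype.ext_iff] using h),
          List.filter_cons_of_pos (by simpa using h), List.map_cons, ih]
      · rw [List.filter_cons_of_neg (by simpa [Subtype.ext_iff] using h),
          List.filter_cons_of_neg (by simpa using h), ih]

theorem represents_delete_vertex {V : Type*} [DecidableEq V] (G : SimpleGraph V)
    (w : List V) (x : V) (hw : Represents w G) :
    Represents
      (w.filterMap (fun z => if h : z ≠ x then some (⟨z, h⟩ : {y : V // y ≠ x}) else none))
      (G.induce {y : V | y ≠ x}) := by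
  refine ⟨fun v => ?_, fun a b hab => ?_⟩
  · exact List.mem_filterMap.2 ⟨v.1, hw.1 v.1, dif_pos v.2⟩
  · have hne : a.1 ≠ b.1 := fun h => hab (Subtype.ext h)
    refine Iff.trans ?_ (hw.2 a.1 b.1 hne)
    unfold Alternates
    rw [← map_val_filter_aux x a b w]
    refine Iff.trans ?_ (List.isChain_map Subtype.val).symm
    have : (fun p q : {y : V // y ≠ x} => p.1 ≠ q.1) = (fun p q => p ≠ q) := by
      funext p q
      simp [Subtype.ext_iff]
    rw [this]
    exact Iff.rfl
end

section
/- Let b_n denote the number of word-representable graphs on the labelled vertex set {1,2,…,n} (i.e. the number of simple graphs G with vertex set {1,…,n} that are word-representable). Then (log₂ b_n)/C(n,2) tends to 2/3 as n tends to infinity, where C(n,2) = n(n−1)/2. -/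
/-! ### Words: prefix counts and the ordered pattern -/

def PrefOrd {V : Type*} [DecidableEq V] (w : List V) (a b : V) : Prop :=
  ∀ p, p <+: w → p.count b ≤ p.count a ∧ p.count a ≤ p.count b + 1

lemma prefOrd_iff {V : Type*} [DecidableEq V] (w : List V) : ∀ (a b : V), a ≠ b →
    (PrefOrd w a b ↔ List.IsChain (· ≠ ·) (b :: w.filter (fun z => z = a ∨ z = b))) := by
  induction w with
  | nil => intro a b hab; simp [PrefOrd]
  | cons c w ih =>
    intro a b hab
    have key : PrefOrd (c :: w) a b ↔ ∀ p, p <+: w →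
        (c :: p).count b ≤ (c :: p).count a ∧ (c :: p).count a ≤ (c :: p).count b + 1 := by
      constructor
      · intro h p hp
        exact h (c :: p) (by simpa using hp)
      · intro h p hp
        rcases p with _ | ⟨d, p⟩
        · simp
        · rw [List.cons_prefix_cons] at hp
          obtain ⟨rfl, hp⟩ := hp
          exact h p hp
    rw [key]
    by_cases hca : c = a
    · subst hca
      have h1 : (c :: w).filter (fun z => z = c ∨ z = b) =
          c :: w.filter (fun z => z = b ∨ z = c) := by
        simp [or_comm]
      rw [h1, List.isChain_cons_cons, ← ih b c (Ne.symm hab)]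
      simp only [PrefOrd, List.count_cons_self, List.count_cons_of_ne hab]
      constructor
      · intro h
        exact ⟨Ne.symm hab, fun p hp => by have := h p hp; omega⟩
      · intro h p hp
        have := h.2 p hp
        omega
    · by_cases hcb : c = b
      · subst hcb
        have h1 : (c :: w).filter (fun z => z = a ∨ z = c) =
          c :: w.filter (fun z => z = a ∨ z = c) := by
          simp
        rw [h1, List.isChain_cons_cons]
        constructor
        · intro h
          have := (h [] (by simp)).1
          simp [Ne.symm hab] at this
        · intro h
          exact absurd rfl h.1
      · have h1 : (c :: w).filter (fun z => z = a ∨ z = b) =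
          w.filter (fun z => z = a ∨ z = b) := by
          simp [hca, hcb]
        rw [h1, ← ih a b hab]
        simp only [PrefOrd, List.count_cons_of_ne hca, List.count_cons_of_ne hcb]

lemma prefOrd_or_of_alternates {V : Type*} [DecidableEq V] (w : List V) (a b : V) (hab : a ≠ b)
    (h : Alternates w a b) : PrefOrd w a b ∨ PrefOrd w b a := by
  rw [prefOrd_iff w a b hab, prefOrd_iff w b a (Ne.symm hab)]
  have h2 : w.filter (fun z => z = b ∨ z = a) = w.filter (fun z => z = a ∨ z = b) := by
    simp [or_comm]
  rw [h2]
  unfold Alternates at h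
  have hm : ∀ z ∈ w.filter (fun z => z = a ∨ z = b), z = a ∨ z = b := by
    intro z hz
    simpa using (List.mem_filter.1 hz).2
  revert h hm
  generalize w.filter (fun z => z = a ∨ z = b) = l
  intro h hm
  rcases l with _ | ⟨c, l⟩
  · simp
  · rcases hm c (by simp) with rfl | rfl
    · left
      rw [List.isChain_cons_cons]
      exact ⟨Ne.symm hab, h⟩
    · right
      rw [List.isChain_cons_cons]
      exact ⟨hab, h⟩

lemma alternates_of_prefOrd {V : Type*} [DecidableEq V] (w : List V) (a b : V) (hab : a ≠ b)
    (h : PrefOrd w a b) : Alternates w a b := by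
  rw [prefOrd_iff w a b hab] at h
  exact h.tail

lemma idxOf_le_of_prefOrd {V : Type*} [DecidableEq V] (w : List V) (a b : V)
    (hb : b ∈ w) (h : PrefOrd w a b) : w.idxOf a ≤ w.idxOf b := by
  have h1 := (h (w.take (w.idxOf b + 1)) (List.take_prefix _ _)).1
  have hlt := List.idxOf_lt_length_of_mem hb
  have h2 : b ∈ w.take (w.idxOf b + 1) := by
    rw [List.mem_take_iff_getElem]
    exact ⟨w.idxOf b, by omega, by simp⟩
  have h3 : 0 < (w.take (w.idxOf b + 1)).count b := List.count_pos_iff.2 h2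
  have h4 : a ∈ w.take (w.idxOf b + 1) := List.count_pos_iff.1 (by omega)
  rw [List.mem_take_iff_getElem] at h4
  obtain ⟨i, hi, rfl⟩ := h4
  have : w.idxOf w[i] ≤ i := by
    by_contra hc
    push Not at hc
    have := List.not_of_lt_findIdx (p := (· == w[i])) (xs := w) (i := i) hc
    simp at this
  omega

theorem exists_order_of_wordRepresentable {V : Type*} [DecidableEq V] (G : SimpleGraph V)
    (hG : WordRepresentable G) : ∃ f : V → ℕ, ∀ a b c d, f a ≤ f b → f b ≤ f c → f c ≤ f d →
      G.Adj a b → G.Adj b c → G.Adj c d → G.Adj a d → G.Adj a c := by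
  obtain ⟨w, hw, hr⟩ := hG
  have hinj : ∀ a b, w.idxOf a = w.idxOf b → a = b := by
    intro a b h
    exact (List.idxOf_inj (hw a)).1 h
  have key : ∀ a b, w.idxOf a ≤ w.idxOf b → G.Adj a b → PrefOrd w a b := by
    intro a b hab hadj
    rcases prefOrd_or_of_alternates w a b hadj.ne ((hr a b hadj.ne).2 hadj) with h | h
    · exact h
    · have := idxOf_le_of_prefOrd w b a (hw a) h
      exact absurd (hinj a b (le_antisymm hab this)) hadj.ne
  refine ⟨fun v => w.idxOf v, fun a b c d h1 h2 h3 hab hbc hcd had => ?_⟩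
  simp only at h1 h2 h3
  have hac : a ≠ c := by
    rintro rfl
    exact hab.ne (hinj a b (le_antisymm h1 h2))
  rw [← hr a c hac]
  apply alternates_of_prefOrd w a c hac
  intro p hp
  have e1 := key a b h1 hab p hp
  have e2 := key b c h2 hbc p hp
  have e3 := key c d h3 hcd p hp
  have e4 := key a d (h1.trans (h2.trans h3)) had p hp
  omega

/-! ### Three-colourable graphs are word-representable -/

lemma filter_toList_both {V : Type*} [DecidableEq V] (S : Finset V) (x y : V) (hxy : x ≠ y)
    (h : ¬ (x ∈ S ∧ y ∈ S)) :
    S.toList.filter (fun z => z = x ∨ z = y) =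
      if x ∈ S then [x] else if y ∈ S then [y] else [] := by
  have hn := S.nodup_toList
  have aux : ∀ t : V, t ∈ S → (∀ z ∈ S, (z = x ∨ z = y) ↔ z = t) →
      S.toList.filter (fun z => z = x ∨ z = y) = [t] := by
    intro t ht hz
    have h1 : S.toList.filter (fun z => z = x ∨ z = y) = S.toList.filter (fun z => z = t) := by
      apply List.filter_congr
      intro z hzS
      exact decide_eq_decide.2 (hz z (by simpa using hzS))
    rw [h1]
    have := List.filter_eq (l := S.toList) (a := t)
    rw [List.count_eq_one_of_mem hn (by simpa using ht)] at this
    simpa [eq_comm] using this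
  split_ifs with h1 h2
  · apply aux x h1
    intro z hz
    constructor
    · rintro (rfl | rfl)
      · rfl
      · exact absurd ⟨h1, hz⟩ h
    · exact Or.inl
  · apply aux y h2
    intro z hz
    constructor
    · rintro (rfl | rfl)
      · exact absurd hz h1
      · rfl
    · exact Or.inr
  · rw [List.filter_eq_nil_iff]
    intro z hz
    simp only [Finset.mem_toList] at hz
    simp only [decide_eq_true_eq]
    rintro (rfl | rfl)
    · exact h1 hz
    · exact h2 hz

noncomputable def colCls {V : Type*} [DecidableEq V] [Fintype V] (c : V → ℕ) (u v : V) (i : ℕ) :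
    Finset V := Finset.univ.filter (fun z => c z = i ∧ z ≠ u ∧ z ≠ v)

noncomputable def pairBlock {V : Type*} [DecidableEq V] [Fintype V] (c : V → ℕ) (u v : V) :
    List V :=
  let W := fun i => (colCls c u v i).toList
  if c v ≤ 1 then W 0 ++ ([v] ++ ([u] ++ (W 1 ++ (W 2 ++ (W 0 ++ ([u] ++ ([v] ++ (W 1 ++ W 2))))))))
  else if 1 ≤ c u then
    W 0 ++ (W 1 ++ ([v] ++ ([u] ++ (W 2 ++ (W 0 ++ (W 1 ++ ([u] ++ ([v] ++ W 2))))))))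
  else W 0 ++ ([u] ++ (W 1 ++ (W 2 ++ ([u] ++ ([v] ++ (W 0 ++ (W 1 ++ ([v] ++ W 2))))))))

/-- the filter to one class in a block -/
lemma filter_colCls {V : Type*} [DecidableEq V] [Fintype V] (c : V → ℕ) (u v x y : V) (i : ℕ)
    (hxy : x ≠ y) (h : ¬ (x ∈ colCls c u v i ∧ y ∈ colCls c u v i)) :
    (colCls c u v i).toList.filter (fun z => z = x ∨ z = y) =
      if c x = i ∧ x ≠ u ∧ x ≠ v then [x] else if c y = i ∧ y ≠ u ∧ y ≠ v then [y] else [] := by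
  rw [filter_toList_both _ x y hxy h]
  simp [colCls]

lemma filter_pairBlock_edge {V : Type*} [DecidableEq V] [Fintype V] (c : V → ℕ) (u v x y : V)
    (huv : u ≠ v) (hc3 : ∀ z, c z < 3) (hcuv : c u ≤ c v) (hxy : c x < c y)
    (hne : ¬ (x = u ∧ y = v)) :
    (pairBlock c u v).filter (fun z => z = x ∨ z = y) = [x, y, x, y] := by
  have hxy' : x ≠ y := by rintro rfl; omega
  have hW : ∀ i, (colCls c u v i).toList.filter (fun z => z = x ∨ z = y) =
      if c x = i ∧ x ≠ u ∧ x ≠ v then [x] else if c y = i ∧ y ≠ u ∧ y ≠ v then [y] else [] := by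
    intro i
    apply filter_colCls _ _ _ _ _ _ hxy'
    simp only [colCls, Finset.mem_filter]
    omega
  have hx3 := hc3 x
  have hy3 := hc3 y
  have hu3 := hc3 u
  have hv3 := hc3 v
  by_cases hxu : x = u
  · subst hxu
    have hyv : y ≠ v := fun h => hne ⟨rfl, h⟩
    have hyx := Ne.symm hxy'
    have hvx := Ne.symm huv
    have hvy := Ne.symm hyv
    simp only [pairBlock]
    split_ifs <;>
    simp only [List.filter_append, hW, List.filter_cons, List.filter_nil] <;>
    simp [hyv, hyx, hvx, hvy, huv] <;> grind
  · by_cases hxv : x = v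
    · subst hxv
      have hyu : y ≠ u := by rintro rfl; omega
      simp only [pairBlock]
      split_ifs <;>
      simp only [List.filter_append, hW, List.filter_cons, List.filter_nil] <;>
      simp [hyu, Ne.symm hyu, huv, Ne.symm huv, hxy', Ne.symm hxy'] <;> grind
    · by_cases hyu : y = u
      · subst hyu
        simp only [pairBlock]
        split_ifs <;>
        simp only [List.filter_append, hW, List.filter_cons, List.filter_nil] <;>
        simp [hxv, Ne.symm hxv, huv, Ne.symm huv, hxy', Ne.symm hxy'] <;> grind
      · by_cases hyv : y = v
        · subst hyv
          simp only [pairBlock]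
          split_ifs <;>
          simp only [List.filter_append, hW, List.filter_cons, List.filter_nil] <;>
          simp [hxu, Ne.symm hxu, huv, Ne.symm huv, hxy', Ne.symm hxy'] <;> grind
        · simp only [pairBlock]
          split_ifs <;>
          simp only [List.filter_append, hW, List.filter_cons, List.filter_nil] <;>
          simp [hxu, Ne.symm hxu, hxv, Ne.symm hxv, hyu, Ne.symm hyu, hyv, Ne.symm hyv] <;> grind

lemma filter_pairBlock_self {V : Type*} [DecidableEq V] [Fintype V] (c : V → ℕ) (u v : V)
    (huv : u ≠ v) :
    ¬ List.IsChain (· ≠ ·) ((pairBlock c u v).filter (fun z => z = u ∨ z = v)) := by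
  have hW : ∀ i, (colCls c u v i).toList.filter (fun z => z = u ∨ z = v) = [] := by
    intro i
    rw [filter_colCls _ _ _ _ _ _ huv (by simp [colCls])]
    simp
  simp only [pairBlock]
  split_ifs <;>
  simp only [List.filter_append, hW, List.filter_cons, List.filter_nil] <;>
  simp

noncomputable def baseBlock {V : Type*} [DecidableEq V] [Fintype V] (c : V → ℕ) : List V :=
  let W := fun i => (Finset.univ.filter (fun z => c z = i)).toList
  W 0 ++ (W 1 ++ W 2)

lemma filter_baseBlock {V : Type*} [DecidableEq V] [Fintype V] (c : V → ℕ) (x y : V)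
    (hc3 : ∀ z, c z < 3) (hxy : c x < c y) :
    (baseBlock c).filter (fun z => z = x ∨ z = y) = [x, y] := by
  have hxy' : x ≠ y := by rintro rfl; omega
  have hW : ∀ i, (Finset.univ.filter (fun z => c z = i)).toList.filter (fun z => z = x ∨ z = y) =
      if c x = i then [x] else if c y = i then [y] else [] := by
    intro i
    rw [filter_toList_both _ x y hxy']
    · simp
    · simp only [Finset.mem_filter]
      omega
  have hx3 := hc3 x
  have hy3 := hc3 y
  simp only [baseBlock, List.filter_append, hW]
  grind

theorem wordRepresentable_of_three_col {V : Type*} [DecidableEq V] [Fintype V]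
    (G : SimpleGraph V) (c : V → ℕ) (hc3 : ∀ z, c z < 3) (hc : ∀ x y, G.Adj x y → c x ≠ c y) :
    WordRepresentable G := by
  classical
  let Q : List (V × V) := (Finset.univ.filter
    (fun q : V × V => q.1 ≠ q.2 ∧ ¬ G.Adj q.1 q.2 ∧ c q.1 ≤ c q.2)).toList
  have hQ : ∀ q, q ∈ Q ↔ (q.1 ≠ q.2 ∧ ¬ G.Adj q.1 q.2 ∧ c q.1 ≤ c q.2) := by
    intro q; simp [Q]
  let w : List V := baseBlock c ++ Q.flatMap (fun q => pairBlock c q.1 q.2)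
  have hedge : ∀ x y, G.Adj x y → c x < c y → Alternates w x y := by
    intro x y hadj hlt
    unfold Alternates
    have hne := hadj.ne
    have aux : ∀ R : List (V × V), (∀ q ∈ R, q ∈ Q) → List.IsChain (· ≠ ·)
        (y :: (R.flatMap (fun q => pairBlock c q.1 q.2)).filter (fun z => z = x ∨ z = y)) := by
      intro R
      induction R with
      | nil => intro _; simp
      | cons q R ih =>
        intro hR
        have hq := (hQ q).1 (hR q (by simp))
        have ih' := ih (fun q hq => hR q (by simp [hq]))
        rw [List.flatMap_cons, List.filter_append, filter_pairBlock_edge c q.1 q.2 x y hq.1 hc3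
          hq.2.2 hlt (by rintro ⟨rfl, rfl⟩; exact hq.2.1 hadj)]
        simp only [List.cons_append, List.nil_append, List.isChain_cons_cons]
        exact ⟨hne.symm, hne, hne.symm, hne, ih'⟩
    have := aux Q (fun q hq => hq)
    simp only [w, List.filter_append, filter_baseBlock c x y hc3 hlt]
    simp only [List.cons_append, List.nil_append]
    exact List.isChain_cons_cons.2 ⟨hne, this⟩
  have hcomm : ∀ x y, Alternates w x y → Alternates w y x := by
    intro x y h
    unfold Alternates at *
    have h2 : w.filter (fun z => z = y ∨ z = x) = w.filter (fun z => z = x ∨ z = y) := by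
      simp [or_comm]
    rwa [h2]
  have hnon : ∀ x y, x ≠ y → ¬ G.Adj x y → c x ≤ c y → ¬ Alternates w x y := by
    intro x y hne hna hle halt
    unfold Alternates at halt
    have hq : (x, y) ∈ Q := (hQ _).2 ⟨hne, hna, hle⟩
    apply filter_pairBlock_self c x y hne
    refine List.IsChain.infix halt ?_
    apply List.IsInfix.filter
    have h1 : pairBlock c x y <:+: Q.flatMap (fun q => pairBlock c q.1 q.2) := by
      obtain ⟨s, t, hst⟩ := List.append_of_mem hq
      rw [hst, List.flatMap_append, List.flatMap_cons]
      exact ⟨_, _, by rw [List.append_assoc]⟩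
    exact h1.trans (List.suffix_append _ _).isInfix
  refine ⟨w, ?_, ?_⟩
  · intro v
    apply List.mem_append_left
    have := hc3 v
    simp only [baseBlock, List.mem_append, Finset.mem_toList, Finset.mem_filter, Finset.mem_univ,
      true_and]
    omega
  · intro x y hne
    constructor
    · intro h
      by_contra hna
      rcases le_total (c x) (c y) with hle | hle
      · exact hnon x y hne hna hle h
      · exact hnon y x hne.symm (fun h => hna h.symm) hle (hcomm _ _ h)
    · intro hadj
      rcases lt_or_gt_of_ne (hc x y hadj) with hlt | hlt
      · exact hedge x y hadj hlt
      · exact hcomm _ _ (hedge y x hadj.symm hlt)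

/-! ### Embedding the pattern in regular quadruples -/

lemma exists_separated {V ι : Type*} [DecidableEq V] [DecidableEq ι] (f : V → ℕ) (k : ℕ) :
    ∀ (I : Finset ι) (X : ι → Finset V), I.card = k →
    ∃ (l : List ι) (Y : ι → Finset V), l.length = k ∧ l.Nodup ∧ (∀ i ∈ l, i ∈ I) ∧
      (∀ i, Y i ⊆ X i) ∧ (∀ i ∈ I, (X i).card ≤ 2 ^ k * (Y i).card) ∧
      l.Pairwise (fun i j => ∀ x ∈ Y i, ∀ y ∈ Y j, f x ≤ f y) := by
  induction k with
  | zero =>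
    intro I X hI
    rw [Finset.card_eq_zero] at hI
    subst hI
    exact ⟨[], X, by simp⟩
  | succ k ih =>
    intro I X hI
    have hne : I.Nonempty := by rw [← Finset.card_pos]; omega
    have hex : ∃ t, ∃ i ∈ I, (X i).card ≤ 2 * ((X i).filter (fun x => f x ≤ t)).card := by
      obtain ⟨i, hi⟩ := hne
      refine ⟨(X i).sup f, i, hi, ?_⟩
      rw [Finset.filter_true_of_mem]
      · omega
      · intro x hx
        exact Finset.le_sup hx
    classical
    let t := Nat.find hex
    obtain ⟨i, hi, hit⟩ := Nat.find_spec hex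
    have hmin : ∀ j ∈ I, (X j).card ≤ 2 * ((X j).filter (fun x => t ≤ f x)).card := by
      intro j hj
      have hsplit := Finset.card_filter_add_card_filter_not (s := X j) (fun x => t ≤ f x)
      by_cases ht : t = 0
      · rw [Finset.filter_true_of_mem]
        · omega
        · intro x _; omega
      · have := Nat.find_min hex (m := t - 1) (by omega)
        push Not at this
        have h2 := this j hj
        have h3 : (X j).filter (fun x => ¬ t ≤ f x) = (X j).filter (fun x => f x ≤ t - 1) := by
          apply Finset.filter_congr
          intro x _
          omega
        rw [h3] at hsplit
        omega
    obtain ⟨l, Y, hlen, hnd, hmem, hsub, hcard, hpw⟩ := ih (I.erase i)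
      (fun j => (X j).filter (fun x => t ≤ f x)) (by rw [Finset.card_erase_of_mem hi, hI]; rfl)
    have hil : i ∉ l := fun h => by simpa using hmem i h
    refine ⟨i :: l, fun j => if j = i then (X i).filter (fun x => f x ≤ t) else Y j,
      by simp [hlen], List.nodup_cons.2 ⟨hil, hnd⟩, ?_, ?_, ?_, ?_⟩
    · intro j hj
      rcases List.mem_cons.1 hj with rfl | hj
      · exact hi
      · exact Finset.mem_of_mem_erase (hmem j hj)
    · intro j
      by_cases hj : j = i
      · subst hj; simp
      · simp only [hj, if_false]
        exact (hsub j).trans (Finset.filter_subset _ _)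
    · intro j hj
      by_cases hji : j = i
      · subst hji
        simp only [if_true]
        refine hit.trans ?_
        gcongr
        rw [pow_succ]
        have : 0 < 2 ^ k := by positivity
        omega
      · simp only [hji, if_false]
        have h1 := hmin j hj
        have h2 := hcard j (Finset.mem_erase.2 ⟨hji, hj⟩)
        rw [pow_succ]
        nlinarith
    · rw [List.pairwise_cons]
      constructor
      · intro j hj x hx y hy
        have hji : j ≠ i := by rintro rfl; exact hil hj
        simp only [if_true, Finset.mem_filter] at hx
        simp only [hji, if_false] at hy
        have := (Finset.mem_filter.1 (hsub j hy)).2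
        omega
      · refine hpw.imp_of_mem ?_
        intro a b ha hb h
        have hai : a ≠ i := by rintro rfl; exact hil ha
        have hbi : b ≠ i := by rintro rfl; exact hil hb
        simpa only [hai, hbi, if_false] using h

/-- every pair of large subsets spans many `R`-pairs -/
def DenseRel {V : Type*} [DecidableEq V] (R : V → V → Prop) [DecidableRel R] (ε c : ℝ)
    (A B : Finset V) : Prop :=
  ∀ X ⊆ A, ∀ Y ⊆ B, ε * A.card ≤ X.card → ε * B.card ≤ Y.card →
    c * X.card * Y.card ≤ ((X ×ˢ Y).filter (fun q => R q.1 q.2)).card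

lemma card_bad_lt {V : Type*} [DecidableEq V] (R : V → V → Prop) [DecidableRel R] {ε c : ℝ}
    {A B Y : Finset V} (hd : DenseRel R ε c A B) (hε : 0 < ε) (hA : A.Nonempty) (hY : Y ⊆ B)
    (hYc : ε * B.card ≤ Y.card) :
    ((A.filter (fun x => ((Y.filter (fun y => R x y)).card : ℝ) < c * Y.card)).card : ℝ)
      < ε * A.card := by
  by_contra! h
  set X := A.filter (fun x => ((Y.filter (fun y => R x y)).card : ℝ) < c * Y.card) with hX
  have hApos : (0 : ℝ) < A.card := by exact_mod_cast hA.card_pos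
  have hXne : X.Nonempty := by
    rw [← Finset.card_pos]
    have : (0 : ℝ) < X.card := lt_of_lt_of_le (by positivity) h
    exact_mod_cast this
  have h1 := hd X (Finset.filter_subset _ _) Y hY h hYc
  have h2 : ((X ×ˢ Y).filter (fun q => R q.1 q.2)).card =
      ∑ x ∈ X, (Y.filter (fun y => R x y)).card := by
    simp only [Finset.card_filter]
    rw [Finset.sum_product]
  rw [h2] at h1
  push_cast at h1
  have h3 : ∑ x ∈ X, ((Y.filter (fun y => R x y)).card : ℝ) < ∑ x ∈ X, c * (Y.card : ℝ) :=
    Finset.sum_lt_sum_of_nonempty hXne (fun x hx => (Finset.mem_filter.1 hx).2)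
  rw [Finset.sum_const, nsmul_eq_mul] at h3
  linarith

set_option maxHeartbeats 1000000 in
lemma exists_pattern {V : Type*} [DecidableEq V] (G : SimpleGraph V) [DecidableRel G.Adj]
    {ε c : ℝ} (hε : 0 < ε) (hε1 : 3 * ε ≤ 1 / 16) (hc : 0 < c) (hc1 : c ≤ 1)
    (hεc : 2 * ε ≤ c * c / 16)
    {A B C D A' B' C' D' : Finset V} (hA : A.Nonempty) (hB : B.Nonempty) (hC : C.Nonempty)
    (hD : D.Nonempty)
    (sA : A' ⊆ A) (sB : B' ⊆ B) (sC : C' ⊆ C) (sD : D' ⊆ D)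
    (cA : A.card ≤ 16 * A'.card) (cB : B.card ≤ 16 * B'.card) (cC : C.card ≤ 16 * C'.card)
    (cD : D.card ≤ 16 * D'.card)
    (AB : DenseRel G.Adj ε c A B) (AD : DenseRel G.Adj ε c A D)
    (AC : DenseRel (fun x y => ¬ G.Adj x y) ε c A C) (BC : DenseRel G.Adj ε c B C)
    (CD : DenseRel G.Adj ε c C D) :
    ∃ a ∈ A', ∃ b ∈ B', ∃ c ∈ C', ∃ d ∈ D', G.Adj a b ∧ G.Adj b c ∧ G.Adj c d ∧ G.Adj a d ∧
      ¬ G.Adj a c := by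
  have cA' : (A.card : ℝ) ≤ 16 * A'.card := by exact_mod_cast cA
  have cB' : (B.card : ℝ) ≤ 16 * B'.card := by exact_mod_cast cB
  have cC' : (C.card : ℝ) ≤ 16 * C'.card := by exact_mod_cast cC
  have cD' : (D.card : ℝ) ≤ 16 * D'.card := by exact_mod_cast cD
  have pA : (0 : ℝ) < A.card := by exact_mod_cast hA.card_pos
  have pB : (0 : ℝ) < B.card := by exact_mod_cast hB.card_pos
  have pC : (0 : ℝ) < C.card := by exact_mod_cast hC.card_pos
  have pD : (0 : ℝ) < D.card := by exact_mod_cast hD.card_pos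
  have hcc : c * c ≤ c := by nlinarith
  have e1 := card_bad_lt G.Adj AB hε hA sB (by nlinarith)
  have e2 := card_bad_lt G.Adj AD hε hA sD (by nlinarith)
  have e3 := card_bad_lt (fun x y => ¬ G.Adj x y) AC hε hA sC (by nlinarith)
  set X1 := A.filter (fun x => ((B'.filter (fun y => G.Adj x y)).card : ℝ) < c * B'.card) with hX1
  set X2 := A.filter (fun x => ((D'.filter (fun y => G.Adj x y)).card : ℝ) < c * D'.card) with hX2
  set X3 := A.filter (fun x => ((C'.filter (fun y => ¬ G.Adj x y)).card : ℝ) < c * C'.card)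
    with hX3
  have hex : ∃ a ∈ A', a ∉ X1 ∪ X2 ∪ X3 := by
    by_contra! hcon
    have h1 : A'.card ≤ X1.card + X2.card + X3.card :=
      (Finset.card_le_card hcon).trans ((Finset.card_union_le _ _).trans
        (Nat.add_le_add_right (Finset.card_union_le _ _) _))
    have h2 : (A'.card : ℝ) ≤ X1.card + X2.card + X3.card := by exact_mod_cast h1
    nlinarith
  obtain ⟨a, ha, han⟩ := hex
  simp only [Finset.mem_union, not_or, hX1, hX2, hX3, Finset.mem_filter, sA ha, true_and,
    not_lt] at han
  obtain ⟨⟨f1, f2⟩, f3⟩ := han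
  set B2 := B'.filter (fun y => G.Adj a y)
  set D2 := D'.filter (fun y => G.Adj a y)
  set C2 := C'.filter (fun y => ¬ G.Adj a y)
  have sC2 : C2 ⊆ C := (Finset.filter_subset _ _).trans sC
  have sD2 : D2 ⊆ D := (Finset.filter_subset _ _).trans sD
  have sB2 : B2 ⊆ B := (Finset.filter_subset _ _).trans sB
  have gB : c / 16 * B.card ≤ B2.card := by nlinarith
  have gC : c / 16 * C.card ≤ C2.card := by nlinarith
  have gD : c / 16 * D.card ≤ D2.card := by nlinarith
  have hεc' : ε < c / 16 := by nlinarith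
  have e4 := card_bad_lt G.Adj BC hε hB sC2 (by nlinarith)
  set X4 := B.filter (fun x => ((C2.filter (fun y => G.Adj x y)).card : ℝ) < c * C2.card) with hX4
  have hex2 : ∃ b ∈ B2, b ∉ X4 := by
    by_contra! hcon
    have h1 : B2.card ≤ X4.card := Finset.card_le_card hcon
    have h2 : (B2.card : ℝ) ≤ X4.card := by exact_mod_cast h1
    nlinarith
  obtain ⟨b, hb, hbn⟩ := hex2
  simp only [hX4, Finset.mem_filter, sB2 hb, true_and, not_lt] at hbn
  set C3 := C2.filter (fun y => G.Adj b y)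
  have gC3 : c * c / 16 * C.card ≤ C3.card := by
    have := mul_le_mul_of_nonneg_left gC hc.le
    linarith
  have h5 := CD C3 ((Finset.filter_subset _ _).trans sC2) D2 sD2 (by nlinarith) (by nlinarith)
  have p3 : (0 : ℝ) < C3.card := lt_of_lt_of_le (by positivity) gC3
  have p4 : (0 : ℝ) < D2.card := lt_of_lt_of_le (by positivity) gD
  have h6 : (0 : ℝ) < ((C3 ×ˢ D2).filter (fun q => G.Adj q.1 q.2)).card :=
    lt_of_lt_of_le (by positivity) h5
  have h7 : 0 < ((C3 ×ˢ D2).filter (fun q => G.Adj q.1 q.2)).card := by exact_mod_cast h6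
  obtain ⟨⟨x, y⟩, hq⟩ := Finset.card_pos.1 h7
  rw [Finset.mem_filter, Finset.mem_product] at hq
  obtain ⟨⟨hx, hy⟩, hxy⟩ := hq
  simp only at hx hy hxy
  have hx1 := Finset.mem_filter.1 hx
  have hx2 := Finset.mem_filter.1 hx1.1
  have hy1 := Finset.mem_filter.1 hy
  have hb1 := Finset.mem_filter.1 hb
  exact ⟨a, ha, b, hb1.1, x, hx2.1, y, hy1.1, hb1.2, hx1.2, hxy, hy1.2, hx2.2⟩

/-- grey pairs: uniform and of intermediate density -/
def GreyPair {V : Type*} [DecidableEq V] (G : SimpleGraph V) [DecidableRel G.Adj] (ε δ : ℝ)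
    (U W : Finset V) : Prop :=
  U ≠ W ∧ G.IsUniform ε U W ∧ δ ≤ (G.edgeDensity U W : ℝ) ∧ (G.edgeDensity U W : ℝ) ≤ 1 - δ

lemma GreyPair.symm {V : Type*} [DecidableEq V] {G : SimpleGraph V} [DecidableRel G.Adj]
    {ε δ : ℝ} {U W : Finset V} (h : GreyPair G ε δ U W) : GreyPair G ε δ W U := by
  refine ⟨h.1.symm, h.2.1.symm, ?_, ?_⟩
  · rw [G.edgeDensity_comm]; exact h.2.2.1
  · rw [G.edgeDensity_comm]; exact h.2.2.2

lemma GreyPair.dense {V : Type*} [DecidableEq V] {G : SimpleGraph V} [DecidableRel G.Adj]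
    {ε δ : ℝ} {U W : Finset V} (h : GreyPair G ε δ U W) (hε : ε ≤ δ / 2) :
    DenseRel G.Adj ε (δ / 2) U W ∧ DenseRel (fun x y => ¬ G.Adj x y) ε (δ / 2) U W := by
  obtain ⟨-, hu, h1, h2⟩ := h
  have key : ∀ X ⊆ U, ∀ Y ⊆ W, ε * U.card ≤ X.card → ε * W.card ≤ Y.card →
      δ / 2 * X.card * Y.card ≤ ((X ×ˢ Y).filter (fun q => G.Adj q.1 q.2)).card ∧
      ((X ×ˢ Y).filter (fun q => G.Adj q.1 q.2)).card ≤ (1 - δ / 2) * X.card * Y.card := by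
    intro X hX Y hY cX cY
    have h3 := hu hX hY (by linarith) (by linarith)
    rw [abs_sub_lt_iff] at h3
    rcases X.eq_empty_or_nonempty with rfl | hXn
    · simp
    rcases Y.eq_empty_or_nonempty with rfl | hYn
    · simp
    have pX : (0 : ℝ) < X.card := by exact_mod_cast hXn.card_pos
    have pY : (0 : ℝ) < Y.card := by exact_mod_cast hYn.card_pos
    have h4 : (G.edgeDensity X Y : ℝ) =
        ((X ×ˢ Y).filter (fun q => G.Adj q.1 q.2)).card / (X.card * Y.card) := by
      rw [G.edgeDensity_def]
      push_cast
      rfl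
    rw [h4] at h3
    set E : ℝ := (((X ×ˢ Y).filter (fun q => G.Adj q.1 q.2)).card : ℝ)
    have h5 : δ / 2 ≤ E / (X.card * Y.card) := by linarith
    have h6 : E / (X.card * Y.card) ≤ 1 - δ / 2 := by linarith
    rw [le_div_iff₀ (by positivity)] at h5
    rw [div_le_iff₀ (by positivity)] at h6
    constructor <;> linarith
  constructor
  · intro X hX Y hY cX cY
    exact (key X hX Y hY cX cY).1
  · intro X hX Y hY cX cY
    have h3 := (key X hX Y hY cX cY).2
    have h4 := Finset.card_filter_add_card_filter_not (s := X ×ˢ Y) (fun q => G.Adj q.1 q.2)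
    rw [Finset.card_product] at h4
    have h5 : (((X ×ˢ Y).filter (fun q => G.Adj q.1 q.2)).card : ℝ) +
        ((X ×ˢ Y).filter (fun q => ¬ G.Adj q.1 q.2)).card = X.card * Y.card := by
      exact_mod_cast h4
    linarith

/-- no four pairwise grey sets -/
lemma no_four_grey {V : Type*} [DecidableEq V] (G : SimpleGraph V) [DecidableRel G.Adj]
    (f : V → ℕ) (hf : ∀ a b c d, f a ≤ f b → f b ≤ f c → f c ≤ f d →
      G.Adj a b → G.Adj b c → G.Adj c d → G.Adj a d → G.Adj a c)
    {ε δ : ℝ} (hδ : 0 < δ) (hδ1 : δ ≤ 1) (hε : 0 < ε) (hε1 : ε ≤ δ * δ / 128)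
    (I : Finset (Finset V)) (hI : I.card = 4) (hne : ∀ U ∈ I, U.Nonempty)
    (hgrey : ∀ U ∈ I, ∀ W ∈ I, U ≠ W → GreyPair G ε δ U W) : False := by
  obtain ⟨l, Y, hlen, hnd, hmem, hsub, hcard, hpw⟩ := exists_separated f 4 I id hI
  rcases l with _ | ⟨A, _ | ⟨B, _ | ⟨C, _ | ⟨D, _ | ⟨E, l⟩⟩⟩⟩⟩ <;> simp at hlen
  simp only [List.nodup_cons, List.mem_cons, not_or, List.not_mem_nil, not_false_eq_true,
    List.nodup_nil, and_true] at hnd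
  simp only [List.pairwise_cons, List.mem_cons, List.not_mem_nil, or_false, forall_eq_or_imp,
    forall_eq] at hpw
  have mA : A ∈ I := hmem A (by simp)
  have mB : B ∈ I := hmem B (by simp)
  have mC : C ∈ I := hmem C (by simp)
  have mD : D ∈ I := hmem D (by simp)
  have hεδ : ε ≤ δ / 2 := by nlinarith
  have gr : ∀ U ∈ I, ∀ W ∈ I, U ≠ W → DenseRel G.Adj ε (δ / 2) U W ∧
      DenseRel (fun x y => ¬ G.Adj x y) ε (δ / 2) U W :=
    fun U hU W hW h => (hgrey U hU W hW h).dense hεδ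
  obtain ⟨a, ha, b, hb, c, hc, d, hd, hab, hbc, hcd, had, hac⟩ :=
    exists_pattern G hε (by nlinarith) (half_pos hδ) (by linarith) (by nlinarith)
      (hne A mA) (hne B mB) (hne C mC) (hne D mD) (hsub A) (hsub B) (hsub C) (hsub D)
      (hcard A mA) (hcard B mB) (hcard C mC) (hcard D mD)
      (gr A mA B mB hnd.1.1).1 (gr A mA D mD hnd.1.2.2).1 (gr A mA C mC hnd.1.2.1).2
      (gr B mB C mC hnd.2.1.1).1 (gr C mC D mD hnd.2.2).1
  exact hac (hf a b c d (hpw.1.1 a ha b hb) (hpw.2.1.1 b hb c hc) (hpw.2.2.1 c hc d hd)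
    hab hbc hcd had)

/-! ### Structure of word-representable graphs -/

/-- the graph of grey pairs of a blown-up matrix -/
def blowGraph {V : Type*} {M : ℕ} (p : V → Fin M) (g : Fin M → Fin M → Bool) : SimpleGraph V where
  Adj x y := x ≠ y ∧ g (p x) (p y) = true ∧ g (p y) (p x) = true
  symm := ⟨fun _ _ h => ⟨h.1.symm, h.2.2, h.2.1⟩⟩
  loopless := ⟨fun _ h => h.1 rfl⟩

open Classical in
theorem regular_description (δ : ℝ) (hδ : 0 < δ) (hδ1 : δ ≤ 1) :
    ∃ M L : ℕ, ∀ n ≥ L, ∀ G : SimpleGraph (Fin n), WordRepresentable G →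
      ∃ (p : Fin n → Fin M) (g b : Fin M → Fin M → Bool),
        (blowGraph p g).CliqueFree 4 ∧
        (((Finset.univ : Finset (Fin n × Fin n)).filter (fun q => q.1 ≠ q.2 ∧
          ¬ (blowGraph p g).Adj q.1 q.2 ∧ ¬ (G.Adj q.1 q.2 ↔ b (p q.1) (p q.2) = true))).card : ℝ)
          ≤ 13 * δ * n ^ 2 := by
  set ε : ℝ := δ * δ / 128 with hε
  have hεpos : 0 < ε := by positivity
  have hεδ : ε ≤ δ / 128 := by rw [hε]; nlinarith
  set l : ℕ := ⌈4 / ε⌉₊ with hl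
  refine ⟨SzemerediRegularity.bound ε l, max l 1, fun n hn G hG => ?_⟩
  obtain ⟨f, hf⟩ := exists_order_of_wordRepresentable G hG
  obtain ⟨P, hP, hlP, hPb, hPu⟩ := szemeredi_regularity G (l := l) hεpos
    (by simpa using (le_max_left _ _).trans hn)
  have hMpos : 0 < SzemerediRegularity.bound ε l := SzemerediRegularity.bound_pos _ _
  have hn1 : 1 ≤ n := (le_max_right _ _).trans hn
  -- index the parts
  obtain ⟨e, he⟩ : ∃ e : Fin (SzemerediRegularity.bound ε l) → Finset (Fin n),
      ∀ U ∈ P.parts, ∃ i, e i = U := by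
    refine ⟨fun i => P.parts.toList.getD i ∅, fun U hU => ?_⟩
    have hU' : U ∈ P.parts.toList := by simpa using hU
    obtain ⟨i, hi, hiU⟩ := List.getElem_of_mem hU'
    have hi' : i < SzemerediRegularity.bound ε l := by
      rw [Finset.length_toList] at hi; omega
    exact ⟨⟨i, hi'⟩, (List.getD_eq_getElem _ _ hi).trans hiU⟩
  have hpex : ∀ x : Fin n, ∃ i, e i ∈ P.parts ∧ x ∈ e i := by
    intro x
    obtain ⟨U, hU, hx⟩ := P.exists_mem (Finset.mem_univ x)
    obtain ⟨i, rfl⟩ := he U hU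
    exact ⟨i, hU, hx⟩
  choose p hpP hpx using hpex
  let g : Fin (SzemerediRegularity.bound ε l) → Fin (SzemerediRegularity.bound ε l) → Bool :=
    fun i j => decide (GreyPair G ε δ (e i) (e j))
  let b : Fin (SzemerediRegularity.bound ε l) → Fin (SzemerediRegularity.bound ε l) → Bool :=
    fun i j => decide (1 - δ < (G.edgeDensity (e i) (e j) : ℝ))
  have hadj : ∀ x y, (blowGraph p g).Adj x y ↔ GreyPair G ε δ (e (p x)) (e (p y)) := by
    intro x y
    simp only [blowGraph, g, decide_eq_true_eq]
    constructor
    · exact fun h => h.2.1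
    · intro h
      refine ⟨?_, h, h.symm⟩
      rintro rfl
      exact h.1 rfl
  refine ⟨p, g, b, ?_, ?_⟩
  · intro s hs
    rw [SimpleGraph.isNClique_iff] at hs
    obtain ⟨hs1, hs2⟩ := hs
    have hinj : Set.InjOn (fun x => e (p x)) s := by
      intro x hx y hy hxy
      by_contra hne
      have := (hadj x y).1 (hs1 hx hy hne)
      exact this.1 hxy
    refine no_four_grey G f hf hδ hδ1 hεpos le_rfl (s.image (fun x => e (p x))) ?_ ?_ ?_
    · rw [Finset.card_image_of_injOn hinj, hs2]
    · intro U hU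
      obtain ⟨x, -, rfl⟩ := Finset.mem_image.1 hU
      exact ⟨x, hpx x⟩
    · intro U hU W hW hUW
      obtain ⟨x, hx, rfl⟩ := Finset.mem_image.1 hU
      obtain ⟨y, hy, rfl⟩ := Finset.mem_image.1 hW
      exact (hadj x y).1 (hs1 hx hy (by rintro rfl; exact hUW rfl))
  · have hsub : (Finset.univ : Finset (Fin n × Fin n)).filter (fun q => q.1 ≠ q.2 ∧
          ¬ (blowGraph p g).Adj q.1 q.2 ∧ ¬ (G.Adj q.1 q.2 ↔ b (p q.1) (p q.2) = true)) ⊆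
        ((P.nonUniforms G ε).biUnion (fun (U, W) => U ×ˢ W) ∪ P.parts.biUnion Finset.offDiag) ∪
        ((P.sparsePairs G δ).biUnion (fun (U, W) => G.interedges U W) ∪
          (P.sparsePairs Gᶜ δ).biUnion (fun (U, W) => Gᶜ.interedges U W)) := by
      rintro ⟨x, y⟩ hq
      simp only [Finset.mem_filter, Finset.mem_univ, true_and, hadj, b, decide_eq_true_eq] at hq
      obtain ⟨hxy, hgr, hb⟩ := hq
      by_cases hUW : e (p x) = e (p y)
      · apply Finset.mem_union_left
        apply Finset.mem_union_right
        rw [Finset.mem_biUnion]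
        exact ⟨e (p x), hpP x, Finset.mem_offDiag.2 ⟨hpx x, hUW ▸ hpx y, hxy⟩⟩
      by_cases hun : G.IsUniform ε (e (p x)) (e (p y))
      swap
      · apply Finset.mem_union_left
        apply Finset.mem_union_left
        rw [Finset.mem_biUnion]
        exact ⟨(e (p x), e (p y)), by
          rw [Finpartition.mk_mem_nonUniforms]; exact ⟨hpP x, hpP y, hUW, hun⟩,
          Finset.mem_product.2 ⟨hpx x, hpx y⟩⟩
      apply Finset.mem_union_right
      by_cases hlow : (G.edgeDensity (e (p x)) (e (p y)) : ℝ) < δ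
      · by_cases hG : G.Adj x y
        · apply Finset.mem_union_left
          rw [Finset.mem_biUnion]
          exact ⟨(e (p x), e (p y)), by
            rw [Finpartition.mk_mem_sparsePairs]; exact ⟨hpP x, hpP y, hUW, hlow⟩,
            by rw [SimpleGraph.mk_mem_interedges_iff]; exact ⟨hpx x, hpx y, hG⟩⟩
        · have hbb : 1 - δ < (G.edgeDensity (e (p x)) (e (p y)) : ℝ) := by
            by_contra hcon
            exact hb ⟨fun h => absurd h hG, fun h => absurd h hcon⟩
          apply Finset.mem_union_right
          rw [Finset.mem_biUnion]
          have hcomp := G.edgeDensity_add_edgeDensity_compl ⟨x, hpx x⟩ ⟨y, hpx y⟩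
            (P.disjoint (hpP x) (hpP y) hUW)
          have hcomp' : (G.edgeDensity (e (p x)) (e (p y)) : ℝ) +
            (Gᶜ.edgeDensity (e (p x)) (e (p y)) : ℝ) = 1 := by exact_mod_cast hcomp
          exact ⟨(e (p x), e (p y)), by
            rw [Finpartition.mk_mem_sparsePairs]; exact ⟨hpP x, hpP y, hUW, by linarith⟩,
            by rw [SimpleGraph.mk_mem_interedges_iff]; exact ⟨hpx x, hpx y, hxy, hG⟩⟩
      · have hbb : 1 - δ < (G.edgeDensity (e (p x)) (e (p y)) : ℝ) := by
          by_contra hcon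
          exact hgr ⟨hUW, hun, not_lt.1 hlow, not_lt.1 hcon⟩
        have hG : ¬ G.Adj x y := fun h => hb ⟨fun _ => hbb, fun _ => h⟩
        apply Finset.mem_union_right
        rw [Finset.mem_biUnion]
        have hcomp := G.edgeDensity_add_edgeDensity_compl ⟨x, hpx x⟩ ⟨y, hpx y⟩
          (P.disjoint (hpP x) (hpP y) hUW)
        have hcomp' : (G.edgeDensity (e (p x)) (e (p y)) : ℝ) +
          (Gᶜ.edgeDensity (e (p x)) (e (p y)) : ℝ) = 1 := by exact_mod_cast hcomp
        exact ⟨(e (p x), e (p y)), by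
          rw [Finpartition.mk_mem_sparsePairs]; exact ⟨hpP x, hpP y, hUW, by linarith⟩,
          by rw [SimpleGraph.mk_mem_interedges_iff]; exact ⟨hpx x, hpx y, hxy, hG⟩⟩
    have hcard := (Finset.card_le_card hsub).trans ((Finset.card_union_le _ _).trans
      (Nat.add_le_add (Finset.card_union_le _ _) (Finset.card_union_le _ _)))
    have hcard' := (Nat.cast_le (α := ℝ)).2 hcard
    push_cast at hcard'
    have hAne : (Finset.univ : Finset (Fin n)).Nonempty := ⟨⟨0, hn1⟩, Finset.mem_univ _⟩
    have k1 := hP.sum_nonUniforms_lt hAne hεpos hPu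
    have k2 := hP.card_biUnion_offDiag_le hεpos
      ((Nat.le_ceil _).trans (by exact_mod_cast hlP))
    have k3 := hP.card_interedges_sparsePairs_le (G := G) hδ.le
    have k4 := hP.card_interedges_sparsePairs_le (G := Gᶜ) hδ.le
    rw [Finset.card_univ, Fintype.card_fin] at k1 k2 k3 k4
    have hn2 : (0 : ℝ) ≤ (n : ℝ) ^ 2 := by positivity
    have k5 : ε * (n : ℝ) ^ 2 ≤ δ / 128 * (n : ℝ) ^ 2 := by gcongr
    have k6 : 0 ≤ δ * (n : ℝ) ^ 2 := by positivity
    refine hcard'.trans ?_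
    linarith

/-! ### Counting -/

lemma card_small_subsets {α : Type*} [Fintype α] [DecidableEq α] (t x : ℝ) (hx : 0 < x)
    (hx1 : x ≤ 1) :
    (((Finset.univ : Finset (Finset α)).filter (fun E => (E.card : ℝ) ≤ t)).card : ℝ) ≤
      x ^ (-t) * (1 + x) ^ (Fintype.card α) := by
  have h1 : (1 + x) ^ (Fintype.card α) = ∑ E : Finset α, x ^ E.card := by
    have := Finset.prod_one_add (ι := α) (R := ℝ) (f := fun _ => x) (Finset.univ)
    simp only [Finset.prod_const, Finset.card_univ, Finset.powerset_univ] at this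
    exact this
  rw [h1, Finset.mul_sum, Finset.card_eq_sum_ones, Nat.cast_sum]
  calc _ ≤ ∑ E ∈ (Finset.univ : Finset (Finset α)).filter (fun E => (E.card : ℝ) ≤ t),
        x ^ (-t) * x ^ E.card := by
        apply Finset.sum_le_sum
        intro E hE
        have hE' := (Finset.mem_filter.1 hE).2
        rw [← Real.rpow_natCast, ← Real.rpow_add hx, Nat.cast_one]
        apply Real.one_le_rpow_of_pos_of_le_one_of_nonpos hx hx1
        linarith
    _ ≤ _ := by
        apply Finset.sum_le_sum_of_subset_of_nonneg (Finset.filter_subset _ _)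
        intros
        positivity

/-- reconstruct a graph from its description -/
def decodeGraph {n M : ℕ} (p : Fin n → Fin M) (g b : Fin M → Fin M → Bool)
    (F : Finset (Sym2 (Fin n))) (E : Finset (Fin n × Fin n)) : SimpleGraph (Fin n) :=
  SimpleGraph.fromRel (fun x y => ((blowGraph p g).Adj x y ∧ s(x, y) ∈ F) ∨
    (¬ (blowGraph p g).Adj x y ∧ ((b (p x) (p y) = true) ↔ (x, y) ∉ E)))

lemma turan_three {n : ℕ} (H : SimpleGraph (Fin n)) [DecidableRel H.Adj] (h : H.CliqueFree 4) :
    (H.edgeFinset.card : ℝ) ≤ (n : ℝ) ^ 2 / 3 := by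
  have h1 := SimpleGraph.CliqueFree.card_edgeFinset_le (r := 3) h
  simp only [Fintype.card_fin] at h1
  rw [← SimpleGraph.card_edgeFinset_turanGraph] at h1
  have h2 := SimpleGraph.mul_card_edgeFinset_turanGraph_le (n := n) (r := 3)
  have h3 : 3 * H.edgeFinset.card ≤ n ^ 2 := by omega
  have h4 : (3 : ℝ) * H.edgeFinset.card ≤ (n : ℝ) ^ 2 := by exact_mod_cast h3
  linarith

open Classical in
theorem card_upper (δ x : ℝ) (hδ : 0 < δ) (hδ1 : δ ≤ 1) (hx : 0 < x) (hx1 : x ≤ 1) :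
    ∃ M L : ℕ, ∀ n ≥ L, (Nat.card {G : SimpleGraph (Fin n) // WordRepresentable G} : ℝ) ≤
      ((M : ℝ) ^ n * ((2 ^ M) ^ M * (2 ^ M) ^ M)) *
        ((2 : ℝ) ^ ((n : ℝ) ^ 2 / 3) * (x ^ (-(13 * δ * n ^ 2)) * (1 + x) ^ (n * n))) := by
  obtain ⟨M, L, hML⟩ := regular_description δ hδ hδ1
  refine ⟨M, L, fun n hn => ?_⟩
  let T := (Fin n → Fin M) × (Fin M → Fin M → Bool) × (Fin M → Fin M → Bool)
  let S : Finset (Finset (Fin n × Fin n)) :=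
    Finset.univ.filter (fun E => (E.card : ℝ) ≤ 13 * δ * n ^ 2)
  let TT : Finset T := Finset.univ.filter (fun τ => (blowGraph τ.1 τ.2.1).CliqueFree 4)
  let D : T → Finset (SimpleGraph (Fin n)) := fun τ =>
    ((blowGraph τ.1 τ.2.1).edgeFinset.powerset ×ˢ S).image
      (fun q => decodeGraph τ.1 τ.2.1 τ.2.2 q.1 q.2)
  have hsub : (Finset.univ.filter (fun G : SimpleGraph (Fin n) => WordRepresentable G)) ⊆
      TT.biUnion D := by
    intro G hG
    obtain ⟨p, g, b, hcf, herr⟩ := hML n hn G (Finset.mem_filter.1 hG).2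
    rw [Finset.mem_biUnion]
    refine ⟨(p, g, b), Finset.mem_filter.2 ⟨Finset.mem_univ _, hcf⟩, ?_⟩
    rw [Finset.mem_image]
    refine ⟨((blowGraph p g).edgeFinset.filter (fun z => z ∈ G.edgeSet),
      (Finset.univ : Finset (Fin n × Fin n)).filter (fun q => q.1 ≠ q.2 ∧
          ¬ (blowGraph p g).Adj q.1 q.2 ∧ ¬ (G.Adj q.1 q.2 ↔ b (p q.1) (p q.2) = true))), ?_, ?_⟩
    · rw [Finset.mem_product]
      refine ⟨Finset.mem_powerset.2 (Finset.filter_subset _ _), ?_⟩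
      exact Finset.mem_filter.2 ⟨Finset.mem_univ _, herr⟩
    · have key : ∀ x y, x ≠ y → ((((blowGraph p g).Adj x y ∧
          s(x, y) ∈ (blowGraph p g).edgeFinset.filter (fun z => z ∈ G.edgeSet)) ∨
        (¬ (blowGraph p g).Adj x y ∧ ((b (p x) (p y) = true) ↔
          (x, y) ∉ (Finset.univ : Finset (Fin n × Fin n)).filter (fun q => q.1 ≠ q.2 ∧
          ¬ (blowGraph p g).Adj q.1 q.2 ∧
          ¬ (G.Adj q.1 q.2 ↔ b (p q.1) (p q.2) = true))))) ↔ G.Adj x y) := by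
        intro x y hxy
        simp only [Finset.mem_filter, SimpleGraph.mem_edgeFinset, SimpleGraph.mem_edgeSet,
          Finset.mem_univ, true_and]
        by_cases h1 : (blowGraph p g).Adj x y <;> by_cases h2 : G.Adj x y <;>
          by_cases h3 : b (p x) (p y) = true <;> simp [h1, h2, h3, hxy]
      ext x y
      unfold decodeGraph
      rw [SimpleGraph.fromRel_adj]
      constructor
      · rintro ⟨hxy, h | h⟩
        · exact (key x y hxy).1 h
        · exact ((key y x hxy.symm).1 h).symm
      · intro h
        exact ⟨h.ne, Or.inl ((key x y h.ne).2 h)⟩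
  have hS : (S.card : ℝ) ≤ x ^ (-(13 * δ * n ^ 2)) * (1 + x) ^ (n * n) := by
    have := card_small_subsets (α := Fin n × Fin n) (13 * δ * n ^ 2) x hx hx1
    simpa using this
  have hD : ∀ τ ∈ TT, ((D τ).card : ℝ) ≤
      (2 : ℝ) ^ ((n : ℝ) ^ 2 / 3) * (x ^ (-(13 * δ * n ^ 2)) * (1 + x) ^ (n * n)) := by
    intro τ hτ
    have h1 : (D τ).card ≤ _ := Finset.card_image_le
    rw [Finset.card_product, Finset.card_powerset] at h1
    have h2 : ((D τ).card : ℝ) ≤ 2 ^ (blowGraph τ.1 τ.2.1).edgeFinset.card * S.card := by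
      exact_mod_cast h1
    refine h2.trans ?_
    gcongr
    rw [← Real.rpow_natCast]
    apply Real.rpow_le_rpow_of_exponent_le (by norm_num)
    exact turan_three _ (Finset.mem_filter.1 hτ).2
  have hcard : Nat.card {G : SimpleGraph (Fin n) // WordRepresentable G} =
      (Finset.univ.filter (fun G : SimpleGraph (Fin n) => WordRepresentable G)).card := by
    rw [Nat.card_eq_fintype_card, Fintype.card_subtype]
  rw [hcard]
  have hTT : (TT.card : ℝ) ≤ (M : ℝ) ^ n * ((2 ^ M) ^ M * (2 ^ M) ^ M) := by
    have h1 : TT.card ≤ Fintype.card T := Finset.card_le_univ _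
    have h2 : Fintype.card T = M ^ n * ((2 ^ M) ^ M * (2 ^ M) ^ M) := by
      simp [T]
    rw [h2] at h1
    exact_mod_cast h1
  calc _ ≤ ((TT.biUnion D).card : ℝ) := by exact_mod_cast Finset.card_le_card hsub
    _ ≤ ∑ τ ∈ TT, ((D τ).card : ℝ) := by exact_mod_cast Finset.card_biUnion_le
    _ ≤ ∑ τ ∈ TT, (2 : ℝ) ^ ((n : ℝ) ^ 2 / 3) *
        (x ^ (-(13 * δ * n ^ 2)) * (1 + x) ^ (n * n)) := Finset.sum_le_sum hD
    _ = TT.card * ((2 : ℝ) ^ ((n : ℝ) ^ 2 / 3) *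
        (x ^ (-(13 * δ * n ^ 2)) * (1 + x) ^ (n * n))) := by rw [Finset.sum_const, nsmul_eq_mul]
    _ ≤ _ := by gcongr

open Classical in
theorem card_lower (n : ℕ) : 2 ^ (SimpleGraph.turanGraph n 3).edgeFinset.card ≤
    Nat.card {G : SimpleGraph (Fin n) // WordRepresentable G} := by
  have hcard : Nat.card {G : SimpleGraph (Fin n) // WordRepresentable G} =
      (Finset.univ.filter (fun G : SimpleGraph (Fin n) => WordRepresentable G)).card := by
    rw [Nat.card_eq_fintype_card, Fintype.card_subtype]
  rw [hcard, ← Finset.card_powerset]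
  have hinc : ∀ F ∈ (SimpleGraph.turanGraph n 3).edgeFinset.powerset, ∀ x y,
      (SimpleGraph.fromEdgeSet (F : Set (Sym2 (Fin n)))).Adj x y ↔ s(x, y) ∈ F := by
    intro F hF x y
    rw [SimpleGraph.fromEdgeSet_adj]
    constructor
    · intro h; exact_mod_cast h.1
    · intro h
      refine ⟨by exact_mod_cast h, ?_⟩
      have := Finset.mem_powerset.1 hF h
      rw [SimpleGraph.mem_edgeFinset, SimpleGraph.mem_edgeSet] at this
      exact this.ne
  apply Finset.card_le_card_of_injOn 
    (fun F : Finset (Sym2 (Fin n)) => SimpleGraph.fromEdgeSet (F : Set (Sym2 (Fin n))))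
  · intro F hF
    have hF' : F ∈ (SimpleGraph.turanGraph n 3).edgeFinset.powerset := hF
    simp only [Finset.coe_filter, Finset.mem_univ, true_and, Set.mem_setOf_eq]
    apply wordRepresentable_of_three_col _ (fun z => z.val % 3)
      (fun z => Nat.mod_lt _ (by norm_num))
    intro x y hxy
    rw [hinc F hF'] at hxy
    have := Finset.mem_powerset.1 hF' hxy
    rw [SimpleGraph.mem_edgeFinset, SimpleGraph.mem_edgeSet, SimpleGraph.turanGraph_adj] at this
    exact this
  · intro F hF F' hF' h
    ext z
    induction z with
    | _ x y =>
      rw [← hinc F hF, ← hinc F' hF']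
      simp only at h
      rw [h]

theorem logb_lower (n : ℕ) : (n : ℝ) ^ 2 / 3 - 3 ≤
    Real.logb 2 (Nat.card {G : SimpleGraph (Fin n) // WordRepresentable G}) := by
  classical
  have h1 := card_lower n
  have h2 : (SimpleGraph.turanGraph n 3).edgeFinset.card =
      (n ^ 2 - (n % 3) ^ 2) * (3 - 1) / (2 * 3) + (n % 3).choose 2 := by
    convert SimpleGraph.card_edgeFinset_turanGraph (n := n) (r := 3)
  have h3 : n ^ 2 ≤ 3 * ((SimpleGraph.turanGraph n 3).edgeFinset.card + 3) := by
    rw [h2]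
    have : (n % 3) ^ 2 ≤ 2 ^ 2 := Nat.pow_le_pow_left (by omega) 2
    omega
  have h4 : (n : ℝ) ^ 2 ≤ 3 * ((SimpleGraph.turanGraph n 3).edgeFinset.card + 3) := by
    exact_mod_cast h3
  have h5 : ((SimpleGraph.turanGraph n 3).edgeFinset.card : ℝ) ≤
      Real.logb 2 (Nat.card {G : SimpleGraph (Fin n) // WordRepresentable G}) := by
    have h6 : (2 : ℝ) ^ (SimpleGraph.turanGraph n 3).edgeFinset.card ≤
      (Nat.card {G : SimpleGraph (Fin n) // WordRepresentable G} : ℝ) := by exact_mod_cast h1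
    rw [Real.le_logb_iff_rpow_le (by norm_num) (lt_of_lt_of_le (by positivity) h6),
      Real.rpow_natCast]
    exact h6
  linarith

theorem logb_upper (η : ℝ) (hη : 0 < η) : ∃ (C : ℝ) (L : ℕ), ∀ n ≥ L,
    Real.logb 2 (Nat.card {G : SimpleGraph (Fin n) // WordRepresentable G}) ≤
      (1 / 3 + η) * (n : ℝ) ^ 2 + C * n + C := by
  -- choose x
  obtain ⟨x, hx, hx1, hxη⟩ : ∃ x : ℝ, 0 < x ∧ x ≤ 1 ∧ Real.logb 2 (1 + x) ≤ η / 2 := by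
    refine ⟨min 1 ((2 : ℝ) ^ (η / 2) - 1), ?_, min_le_left _ _, ?_⟩
    · apply lt_min one_pos
      have := Real.one_lt_rpow (x := 2) (z := η / 2) (by norm_num) (by positivity)
      linarith
    · have h1 := Real.one_lt_rpow (x := 2) (z := η / 2) (by norm_num) (by positivity)
      have h0 : 0 < min 1 ((2 : ℝ) ^ (η / 2) - 1) := lt_min one_pos (by linarith)
      rw [Real.logb_le_iff_le_rpow (by norm_num) (by linarith)]
      have := min_le_right 1 ((2 : ℝ) ^ (η / 2) - 1)
      linarith
  -- choose δ
  set K : ℝ := - Real.logb 2 x with hK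
  have hK0 : 0 ≤ K := by
    have := Real.logb_nonpos (b := 2) (by norm_num) hx.le hx1
    linarith
  obtain ⟨δ, hδ, hδ1, hδK⟩ : ∃ δ : ℝ, 0 < δ ∧ δ ≤ 1 ∧ 13 * δ * K ≤ η / 2 := by
    refine ⟨min 1 (η / (26 * (K + 1))), lt_min one_pos (by positivity), min_le_left _ _, ?_⟩
    have h1 : min 1 (η / (26 * (K + 1))) * (26 * (K + 1)) ≤ η := by
      rw [← le_div_iff₀ (by positivity)]
      exact min_le_right _ _
    have h2 : 0 < min 1 (η / (26 * (K + 1))) := lt_min one_pos (by positivity)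
    nlinarith
  obtain ⟨M, L, hML⟩ := card_upper δ x hδ hδ1 hx hx1
  refine ⟨|Real.logb 2 M| + 2 * M * M, max L 1, fun n hn => ?_⟩
  have hle := hML n ((le_max_left _ _).trans hn)
  have hpos : (0 : ℝ) < Nat.card {G : SimpleGraph (Fin n) // WordRepresentable G} := by
    have := card_lower n
    exact_mod_cast lt_of_lt_of_le (by positivity) this
  have hM : M ≠ 0 := by
    rintro rfl
    have hn1 : n ≠ 0 := by have := (le_max_right L 1).trans hn; omega
    rw [Nat.cast_zero, zero_pow hn1, zero_mul, zero_mul] at hle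
    linarith
  have hM' : (M : ℝ) ≠ 0 := by exact_mod_cast hM
  have h1 := Real.logb_le_logb_of_le (b := 2) (by norm_num) hpos hle
  have hxp : (0 : ℝ) < x ^ (-(13 * δ * (n : ℝ) ^ 2)) := Real.rpow_pos_of_pos hx _
  have h1x : (0 : ℝ) < 1 + x := by linarith
  have h2p : (0 : ℝ) < (2 : ℝ) ^ ((n : ℝ) ^ 2 / 3) := by positivity
  rw [Real.logb_mul (by positivity) (by positivity), Real.logb_mul (by positivity) (by positivity),
    Real.logb_mul (by positivity) (by positivity), Real.logb_mul (by positivity) (by positivity),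
    Real.logb_mul (by positivity) (by positivity), Real.logb_pow, Real.logb_pow, Real.logb_pow,
    Real.logb_pow, Real.logb_rpow (by norm_num) (by norm_num),
    Real.logb_rpow_eq_mul_logb_of_pos hx, Real.logb_self_eq_one (by norm_num)] at h1
  have hn2 : (0 : ℝ) ≤ (n : ℝ) ^ 2 := by positivity
  have e1 : (n : ℝ) * Real.logb 2 M ≤ |Real.logb 2 M| * n := by
    rw [mul_comm]
    gcongr
    exact le_abs_self _
  have e2 := mul_le_mul_of_nonneg_right hδK hn2
  have e3 := mul_le_mul_of_nonneg_right hxη hn2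
  have e4 : 0 ≤ |Real.logb 2 M| := abs_nonneg _
  have e5 : (0 : ℝ) ≤ 2 * M * M * n := by positivity
  have e6 : 13 * δ * K * (n : ℝ) ^ 2 = -(13 * δ * (n : ℝ) ^ 2) * Real.logb 2 x := by
    rw [hK]; ring
  push_cast at h1
  rw [← e6] at h1
  nlinarith

theorem labelled_speed_wordRepresentable :
    Filter.Tendsto
      (fun n : ℕ =>
        Real.logb 2 (Nat.card {G : SimpleGraph (Fin n) // WordRepresentable G}) /
          (n.choose 2 : ℝ))
      Filter.atTop (nhds (2 / 3)) := by
  rw [Metric.tendsto_atTop]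
  intro θ hθ
  obtain ⟨C, L, hC⟩ := logb_upper (θ / 8) (by positivity)
  -- a large threshold
  obtain ⟨N, hN⟩ := exists_nat_ge (|C| * 16 / θ + 16 / θ + 8)
  refine ⟨max (max L 2) N, fun n hn => ?_⟩
  have hnL : L ≤ n := (le_max_left _ _).trans ((le_max_left _ _).trans hn)
  have hn2 : 2 ≤ n := (le_max_right _ _).trans ((le_max_left _ _).trans hn)
  have hnN : (N : ℝ) ≤ n := by exact_mod_cast (le_max_right _ _).trans hn
  have hup := hC n hnL
  have hlo := logb_lower n
  set B := Real.logb 2 (Nat.card {G : SimpleGraph (Fin n) // WordRepresentable G})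
  rw [Nat.cast_choose_two]
  have hn2' : (2 : ℝ) ≤ n := by exact_mod_cast hn2
  set m : ℝ := (n : ℝ)
  have hm : |C| * 16 / θ + 16 / θ + 8 ≤ m := hN.trans hnN
  have hm' : |C| * 16 + 16 + 8 * θ ≤ m * θ := by
    have h1 := mul_le_mul_of_nonneg_right hm hθ.le
    have h2 : (|C| * 16 / θ + 16 / θ + 8) * θ = |C| * 16 + 16 + 8 * θ := by field_simp
    linarith
  have hCa := le_abs_self C
  have hC0 := abs_nonneg C
  have hpos : 0 < m * (m - 1) / 2 := by nlinarith
  rw [Real.dist_eq, abs_sub_lt_iff]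
  constructor
  · rw [sub_lt_iff_lt_add, div_lt_iff₀ hpos]
    have a1 : C * m + C ≤ |C| * m + |C| := by nlinarith
    have a2 : (|C| * 16 + 16 + 8 * θ) * m ≤ m * θ * m := by gcongr
    nlinarith
  · rw [sub_lt_comm, lt_div_iff₀ hpos]
    have a2 : (|C| * 16 + 16 + 8 * θ) * m ≤ m * θ * m := by gcongr
    nlinarith
end
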